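/- Let p_0 ≥ 10^20, let p > p_0 be prime, let e be an even divisor of p−1, let p_1, …, p_s be the distinct primes dividing p−1 but not dividing e (with s = 0 and δ = 1 if there are none, and otherwise δ = 1 − Σ_{i=1}^{s} 1/p_i), and assume δ > 0. If (φ(e)/e) · (1 − 2/p_0^{1/2}) · p^{1/2} · ( 1 − 3.5751 · (1 − 2/p_0^{1/2})^{−1/2} · (log p)^{1/4} · ((s−1)/δ + 2) · W(e) · p^{−1/16} ) > 0, then g(p) < √p − 2, where W(e) = 2^{ω(e)}. -/

import Mathlib

/-- The least primitive root modulo `p`: the smallest positive integer whose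
residue class has order `p - 1` in `ZMod p` (equivalently, generates `(ZMod p)ˣ`). -/
noncomputable def leastPrimitiveRoot (p : ℕ) : ℕ :=
  sInf {n : ℕ | 0 < n ∧ orderOf ((n : ZMod p)) = p - 1}

section WeilBound

open Polynomial

/-- Base-expansion uniqueness used to separate degrees. -/
theorem digits_unique {A Q d : ℕ} (hQ : A * d ≤ Q) {i i' j j' k k' : ℕ}
    (hj : j < d) (hj' : j' < d) (hk : k < A) (hk' : k' < A)
    (h : k + j * A + (i + j) * Q = k' + j' * A + (i' + j') * Q) :
    i = i' ∧ j = j' := by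
  have hlt : ∀ {j k : ℕ}, j < d → k < A → k + j * A < Q := by
    intro j k hj hk
    have : (j + 1) * A ≤ d * A := Nat.mul_le_mul_right _ hj
    nlinarith
  have h1 := hlt hj hk
  have h2 := hlt hj' hk'
  have hQ0 : 0 < Q := by omega
  have hA0 : 0 < A := by omega
  have e1 : i + j = i' + j' := by
    have := congrArg (· / Q) h
    simpa [Nat.add_mul_div_right _ _ hQ0, Nat.div_eq_of_lt h1, Nat.div_eq_of_lt h2] using this
  rw [e1] at h
  have h3 : k + j * A = k' + j' * A := by omega
  have e2 : j = j' := by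
    have := congrArg (· / A) h3
    simpa [Nat.add_mul_div_right _ _ hA0, Nat.div_eq_of_lt hk, Nat.div_eq_of_lt hk'] using this
  omega

section Stepanov

variable {K : Type*} [Field K] [Fintype K]

omit [Fintype K] in
theorem card_degreeLT (n : ℕ) : Nat.card (degreeLT K n) = Nat.card K ^ n := by
  rw [Nat.card_congr (degreeLTEquiv K n).toEquiv, Nat.card_fun, Nat.card_fin]

omit [Fintype K] in
theorem stepanov_sum_ne_zero {f : K[X]} {A d : ℕ}
    (hf : f.natDegree = d + 1) {I : ℕ}
    (c : Fin I × Fin d → K[X]) (hc : ∀ t, c t ∈ degreeLT K A) (hne : c ≠ 0) :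
    (∑ t, c t * X ^ (t.1.1 * ((A + 1) * d + 1)) * f ^ (t.2.1 * (A + 1))) ≠ 0 ∧
    (∑ t, c t * X ^ (t.1.1 * ((A + 1) * d + 1)) * f ^ (t.2.1 * (A + 1))).natDegree
      ≤ (I + d) * ((A + 1) * d + 1) := by
  have hf0 : f ≠ 0 := by rintro rfl; simp at hf
  set Q := (A + 1) * d + 1 with hQ
  have hdeg : ∀ t, c t ≠ 0 → (c t * X ^ (t.1.1 * Q) * f ^ (t.2.1 * (A + 1))).degree =
      (((c t).natDegree + t.2.1 * A + (t.1.1 + t.2.1) * Q : ℕ) : WithBot ℕ) := by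
    intro t ht
    rw [degree_eq_natDegree (by simp [ht, hf0]), natDegree_mul (by simp [ht]) (by simp [hf0]),
      natDegree_mul ht (by simp), natDegree_X_pow, natDegree_pow, hf, hQ]
    congr 1
    ring
  have hlt : ∀ t, c t ≠ 0 → (c t).natDegree < A := fun t ht =>
    (natDegree_lt_iff_degree_lt ht).2 (mem_degreeLT.1 (hc t))
  have hAQ : A * d ≤ Q := by rw [hQ]; nlinarith
  have key := degree_sum_eq_of_disjoint
    (fun t => c t * X ^ (t.1.1 * Q) * f ^ (t.2.1 * (A + 1))) Finset.univ (by
      rintro s ⟨-, hs⟩ t ⟨-, ht⟩ hst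
      have hs' : c s ≠ 0 := by rintro h; simp [h] at hs
      have ht' : c t ≠ 0 := by rintro h; simp [h] at ht
      simp only [Function.onFun, Function.comp, hdeg s hs', hdeg t ht']
      intro h
      have := digits_unique hAQ s.2.2 t.2.2 (hlt s hs') (hlt t ht') (by exact_mod_cast h)
      exact hst (Prod.ext (Fin.ext this.1) (Fin.ext this.2)))
  constructor
  · obtain ⟨t, ht⟩ := Function.ne_iff.1 hne
    intro h0
    rw [h0, degree_zero] at key
    have h1 := Finset.le_sup (f := fun t => (c t * X ^ (t.1.1 * Q) * f ^ (t.2.1 * (A + 1))).degree)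
      (Finset.mem_univ t)
    rw [← key, hdeg t ht] at h1
    exact WithBot.coe_ne_bot (le_bot_iff.1 h1)
  · rw [natDegree_le_iff_degree_le, key]
    refine Finset.sup_le fun t _ => ?_
    by_cases ht : c t = 0
    · simp [ht]
    rw [hdeg t ht]
    have h1 := hlt t ht
    have h2 := t.1.2
    have h3 := t.2.2
    have h5 : t.2.1 * A ≤ d * A := Nat.mul_le_mul_right _ h3.le
    have h4 : (t.1.1 + t.2.1 + 2) * Q ≤ (I + d) * Q := Nat.mul_le_mul_right _ (by omega)
    have : (c t).natDegree + t.2.1 * A + (t.1.1 + t.2.1) * Q ≤ (I + d) * Q := by nlinarith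
    exact_mod_cast this

theorem stepanov_exists {f : K[X]} {A d p μ : ℕ} [Fact p.Prime] [CharP K p]
    (hp : p = d + 1) (hA : 8 ≤ A) (hQ : p ^ μ = (A + 1) * d + 1)
    (hf : f.natDegree = d + 1) (a : K) :
    ∃ c : Fin (A + 2 * d + 7) × Fin d → K[X], (∀ t, c t ∈ degreeLT K A) ∧ c ≠ 0 ∧
      ∑ t, C (a ^ t.2.1) * c t ^ ((A + 1) * d + 1) * X ^ t.1.1 *
        f ^ ((d - 1 - t.2.1) * (A + 1)) = 0 := by
  classical
  have hd : 1 ≤ d := by have := (Fact.out : p.Prime).two_le; omega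
  set I := A + 2 * d + 7 with hI
  set Q := (A + 1) * d + 1 with hQd
  set T := Q * A + I + (d + 1) * Q with hT
  have hmem : ∀ u : Fin I × Fin d → degreeLT K A,
      ∑ t, C (a ^ t.2.1) * (u t : K[X]) ^ Q * X ^ t.1.1 * f ^ ((d - 1 - t.2.1) * (A + 1))
        ∈ degreeLT K T := by
    intro u
    refine Submodule.sum_mem _ fun t _ => ?_
    rw [mem_degreeLT]
    refine lt_of_le_of_lt degree_le_natDegree ?_
    have hu : (u t : K[X]).natDegree ≤ A := by
      rw [natDegree_le_iff_degree_le]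
      exact (mem_degreeLT.1 (u t).2).le
    have h1 : (C (a ^ t.2.1) * (u t : K[X]) ^ Q * X ^ t.1.1 *
        f ^ ((d - 1 - t.2.1) * (A + 1))).natDegree ≤
        0 + Q * A + t.1.1 + (d - 1 - t.2.1) * (A + 1) * (d + 1) := by
      refine natDegree_mul_le_of_le (natDegree_mul_le_of_le (natDegree_mul_le_of_le
        (by simp) (natDegree_pow_le_of_le _ hu)) (by simp)) ?_
      rw [natDegree_pow, hf]
    have h2 : (d - 1 - t.2.1) * (A + 1) * (d + 1) ≤ (d + 1) * Q := by
      have : (d - 1 - t.2.1) * (A + 1) ≤ d * (A + 1) := Nat.mul_le_mul_right _ (by omega)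
      nlinarith
    have h3 := t.1.2
    exact_mod_cast (by omega : (C (a ^ t.2.1) * (u t : K[X]) ^ Q * X ^ t.1.1 *
        f ^ ((d - 1 - t.2.1) * (A + 1))).natDegree < T)
  let Φ : (Fin I × Fin d → degreeLT K A) → degreeLT K T := fun u => ⟨_, hmem u⟩
  have : Finite (degreeLT K A) := Finite.of_equiv _ (degreeLTEquiv K A).toEquiv.symm
  have : Finite (degreeLT K T) := Finite.of_equiv _ (degreeLTEquiv K T).toEquiv.symm
  have hcard : Nat.card (degreeLT K T) < Nat.card (Fin I × Fin d → degreeLT K A) := by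
    rw [Nat.card_fun, card_degreeLT, card_degreeLT, ← pow_mul]
    refine Nat.pow_lt_pow_right (Finite.one_lt_card) ?_
    simp only [Nat.card_prod, Nat.card_fin]
    rw [hT, hI, hQd]
    nlinarith [Nat.mul_le_mul_right (d * d + 5 * d - 2) hA,
      mul_le_mul hA hd (by omega) (by omega),
      mul_le_mul hA (Nat.mul_le_mul hd hd) (by omega) (by omega)]
  have hinj : ¬ Function.Injective Φ := fun h => absurd (Nat.card_le_card_of_injective Φ h)
    (by omega)
  simp only [Function.Injective, not_forall] at hinj
  obtain ⟨u, v, huv, hne⟩ := hinj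
  refine ⟨fun t => (u t : K[X]) - v t, fun t => Submodule.sub_mem _ (u t).2 (v t).2, ?_, ?_⟩
  · intro h
    apply hne
    funext t
    exact Subtype.ext (sub_eq_zero.1 (congrFun h t))
  · have h1 := congrArg Subtype.val huv
    simp only [Φ] at h1
    rw [← sub_eq_zero, ← Finset.sum_sub_distrib] at h1
    rw [← h1]
    refine Finset.sum_congr rfl fun t _ => ?_
    rw [← hQ, sub_pow_char_pow]
    ring

/-- Stepanov's bound for the number of points with prescribed norm residue, in a field with
`Q ^ 2` elements, `Q = p ^ μ`. -/
theorem stepanov_card_le [DecidableEq K] {f : K[X]} {A d p μ : ℕ} [Fact p.Prime] [CharP K p]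
    (hp : p = d + 1) (hA : 8 ≤ A) (hQ : p ^ μ = (A + 1) * d + 1)
    (hcard : Fintype.card K = (p ^ μ) ^ 2)
    (hf : f.natDegree = d + 1) {a : K} (ha : a ≠ 0) :
    (Finset.univ.filter fun x => f.eval x ^ ((A + 1) * (p ^ μ + 1)) = a).card ≤
      (A + 3 * d + 7) * p ^ μ := by
  have hd : 1 ≤ d := by have := (Fact.out : p.Prime).two_le; omega
  obtain ⟨c, hc, hne, hsum⟩ := stepanov_exists hp hA hQ hf a
  obtain ⟨hG, hGdeg⟩ := stepanov_sum_ne_zero hf c hc hne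
  rw [← hQ] at hG hGdeg hsum
  set G := ∑ t, c t * X ^ (t.1.1 * p ^ μ) * f ^ (t.2.1 * (A + 1))
  have hroot : ∀ x, f.eval x ^ ((A + 1) * (p ^ μ + 1)) = a → x ∈ G.roots := by
    intro x hx
    rw [mem_roots hG, IsRoot.def]
    have hfx : f.eval x ≠ 0 := by
      intro h; rw [h, zero_pow (by positivity)] at hx; exact ha hx.symm
    have hxq : x ^ (p ^ μ * p ^ μ) = x := by
      rw [← sq, ← hcard, FiniteField.pow_card]
    have h0 := congrArg (eval x) hsum
    rw [eval_finsetSum, eval_zero] at h0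
    have h1 : (G.eval x) ^ p ^ μ * f.eval x ^ ((d - 1) * (A + 1)) = 0 := by
      rw [← h0, eval_finsetSum, sum_pow_char_pow, Finset.sum_mul]
      refine Finset.sum_congr rfl fun t _ => ?_
      simp only [eval_mul, eval_pow, eval_X, eval_C, mul_pow]
      have ht := t.2.2
      have e1 : (d - 1) * (A + 1) = t.2.1 * (A + 1) + (d - 1 - t.2.1) * (A + 1) := by
        rw [← add_mul]; congr 1; omega
      have e2 : (x ^ (t.1.1 * p ^ μ)) ^ p ^ μ = x ^ t.1.1 := by
        rw [← pow_mul, mul_assoc, mul_comm, pow_mul, hxq]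
      rw [e1, e2, ← hx, pow_add]
      ring
    have h2 : G.eval x ^ p ^ μ = 0 := by
      rcases mul_eq_zero.1 h1 with h | h
      · exact h
      · exact absurd h (pow_ne_zero _ hfx)
    exact pow_eq_zero_iff (by rw [hQ]; omega) |>.1 h2
  calc _ ≤ G.roots.toFinset.card := Finset.card_le_card fun x hx => by
          simp only [Finset.mem_filter] at hx
          exact Multiset.mem_toFinset.2 (hroot x hx.2)
    _ ≤ Multiset.card G.roots := Multiset.toFinset_card_le _
    _ ≤ G.natDegree := card_roots' _
    _ ≤ _ := hGdeg.trans (Nat.mul_le_mul_right _ (by omega))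

end Stepanov

theorem exists_geom_index {p μ : ℕ} (hp : 2 ≤ p) (hμ : 9 ≤ μ) :
    ∃ A, 8 ≤ A ∧ p ^ μ = (A + 1) * (p - 1) + 1 := by
  have h1 : μ ≤ ∑ i ∈ Finset.range μ, p ^ i := by
    calc μ = ∑ i ∈ Finset.range μ, 1 := by simp
      _ ≤ _ := Finset.sum_le_sum fun i _ => Nat.one_le_pow _ _ (by omega)
  refine ⟨∑ i ∈ Finset.range μ, p ^ i - 1, by omega, ?_⟩
  rw [Nat.sub_add_cancel (by omega)]
  have h2 := Nat.geomSum_eq hp μ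
  have h3 : p - 1 ∣ p ^ μ - 1 := by simpa using Nat.sub_dvd_pow_sub_pow p 1 μ
  rw [h2, Nat.div_mul_cancel h3]
  have := Nat.one_le_pow μ p (by omega)
  omega

/-- Square-root cancellation, with an unspecified constant, for multiplicative character sums
of polynomials of degree `p` over the extensions of `ZMod p` of even degree. -/
theorem norm_sum_char_norm_le {p : ℕ} [Fact p.Prime] (K : Type*) [Field K] [Fintype K]
    [Algebra (ZMod p) K] {μ : ℕ} (hμ : 9 ≤ μ) (hcard : Fintype.card K = (p ^ μ) ^ 2)
    {f : (ZMod p)[X]} (hf : f.natDegree = p) {χ : MulChar (ZMod p) ℂ} (hχ : χ ≠ 1) :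
    ‖∑ x : K, χ (Algebra.norm (ZMod p) (aeval x f))‖ ≤ (4 * p ^ 2 + 8 * p : ℝ) * p ^ μ := by
  classical
  have hp2 := (Fact.out : p.Prime).two_le
  have : CharP K p := charP_of_injective_algebraMap (algebraMap (ZMod p) K).injective p
  obtain ⟨A, hA, hQ⟩ := exists_geom_index hp2 hμ
  set d := p - 1 with hd
  have hpd : p = d + 1 := by omega
  set g := f.map (algebraMap (ZMod p) K) with hg
  have hgd : g.natDegree = d + 1 := by rw [hg, natDegree_map, hf, hpd]
  set U := (A + 3 * d + 7) * p ^ μ with hU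
  set N : ZMod p → ℕ := fun a =>
    (Finset.univ.filter fun x : K => Algebra.norm (ZMod p) (aeval x f) = a).card with hN
  have hNle : ∀ a ≠ 0, N a ≤ U := by
    intro a ha
    refine le_trans (Finset.card_le_card ?_) (stepanov_card_le hpd hA hQ hcard hgd
      (a := algebraMap (ZMod p) K a) (by simpa using ha))
    intro x hx
    simp only [Finset.mem_filter, Finset.mem_univ, true_and] at hx ⊢
    rw [← hx, FiniteField.algebraMap_norm_eq_pow, hg, eval_map_algebraMap]
    congr 1
    rw [Nat.card_eq_fintype_card, hcard, Nat.card_zmod, ← hd]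
    symm
    apply Nat.div_eq_of_eq_mul_left (by omega)
    have : (p ^ μ) ^ 2 - 1 = (p ^ μ + 1) * (p ^ μ - 1) := by
      rw [← Nat.sq_sub_sq, one_pow]
    rw [this, mul_comm (A + 1), mul_assoc]
    congr 1
    omega
  have hN0 : N 0 ≤ p := by
    have hg0 : g ≠ 0 := by rintro h; simp [h] at hgd
    calc N 0 ≤ g.roots.toFinset.card := by
          refine Finset.card_le_card fun x hx => ?_
          simp only [Finset.mem_filter, Finset.mem_univ, true_and] at hx
          rw [Multiset.mem_toFinset, mem_roots hg0, IsRoot.def, hg, eval_map_algebraMap]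
          exact Algebra.norm_eq_zero_iff.1 hx
      _ ≤ Multiset.card g.roots := Multiset.toFinset_card_le _
      _ ≤ g.natDegree := card_roots' _
      _ = p := by omega
  have hsumN : ∑ a, N a = (p ^ μ) ^ 2 := by
    rw [← hcard, ← Finset.card_univ]
    exact (Finset.card_eq_sum_card_fiberwise (fun x _ => Finset.mem_univ _)).symm
  have hS : ∑ x : K, χ (Algebra.norm (ZMod p) (aeval x f)) = ∑ a, χ a * ((N a : ℂ) - U) := by
    have h1 : ∑ a, χ a * ((N a : ℂ) - U) = ∑ a, χ a * N a := by
      simp only [mul_sub, Finset.sum_sub_distrib]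
      rw [← Finset.sum_mul, MulChar.sum_eq_zero_of_ne_one hχ, zero_mul, sub_zero]
    rw [h1, ← Finset.sum_fiberwise (s := Finset.univ)
      (g := fun x : K => Algebra.norm (ZMod p) (aeval x f))]
    refine Finset.sum_congr rfl fun a _ => ?_
    rw [Finset.sum_congr rfl (g := fun _ => χ a) (by
      intro x hx; rw [(Finset.mem_filter.1 hx).2]), Finset.sum_const, nsmul_eq_mul, mul_comm]
  have hsplit : ∑ a, (N a : ℝ) = N 0 + ∑ a ∈ Finset.univ.erase (0 : ZMod p), (N a : ℝ) :=
    (Finset.add_sum_erase _ _ (Finset.mem_univ _)).symm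
  have hbound : ‖∑ a, χ a * ((N a : ℂ) - U)‖ ≤
      ∑ a ∈ Finset.univ.erase (0 : ZMod p), ((U : ℝ) - N a) := by
    rw [← Finset.add_sum_erase _ _ (Finset.mem_univ (0 : ZMod p)), MulChar.map_zero, zero_mul,
      zero_add]
    refine norm_sum_le_of_le _ fun a ha => ?_
    have ha0 := Finset.ne_of_mem_erase ha
    rw [norm_mul]
    have h1 : ‖χ a‖ ≤ 1 := DirichletCharacter.norm_le_one χ a
    have h2 : ‖(N a : ℂ) - U‖ = (U : ℝ) - N a := by
      rw [norm_sub_rev, ← Nat.cast_sub (hNle a ha0), Complex.norm_natCast,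
        Nat.cast_sub (hNle a ha0)]
    rw [h2]
    have h3 : (N a : ℝ) ≤ U := by exact_mod_cast hNle a ha0
    nlinarith [norm_nonneg (χ a)]
  rw [hS]
  refine hbound.trans ?_
  rw [Finset.sum_sub_distrib, Finset.sum_const, Finset.card_erase_of_mem (Finset.mem_univ _),
    Finset.card_univ, ZMod.card, ← hd, nsmul_eq_mul]
  have hs2 : ∑ a, (N a : ℝ) = ((p : ℝ) ^ μ) ^ 2 := by exact_mod_cast hsumN
  have hQr : (p : ℝ) ^ μ = (A + 1) * d + 1 := by exact_mod_cast hQ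
  have hUr : (U : ℝ) = (A + 3 * d + 7) * p ^ μ := by rw [hU]; push_cast; ring
  have hN0r : (N 0 : ℝ) ≤ p := by exact_mod_cast hN0
  have hpr : (p : ℝ) = d + 1 := by rw [← Nat.cast_add_one, ← hpd]
  have hQ1 : (1 : ℝ) ≤ (p : ℝ) ^ μ := one_le_pow₀ (by exact_mod_cast (by omega : 1 ≤ p))
  have hd0 : (0 : ℝ) ≤ d := by positivity
  have hfin : (d : ℝ) * U - ((p : ℝ) ^ μ) ^ 2 + p ≤ (4 * p ^ 2 + 8 * p : ℝ) * p ^ μ := by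
    rw [hUr]
    have : (d : ℝ) * ((A + 3 * d + 7) * p ^ μ) - ((p : ℝ) ^ μ) ^ 2
        = (3 * d ^ 2 + 6 * d - 1) * p ^ μ := by
      linear_combination (-(p : ℝ) ^ μ) * hQr
    rw [this, hpr] at *
    nlinarith [mul_nonneg hd0 (by linarith : (0 : ℝ) ≤ (d + 1 : ℝ) ^ μ - 1),
      mul_nonneg (mul_nonneg hd0 hd0) (by linarith : (0 : ℝ) ≤ (d + 1 : ℝ) ^ μ - 1)]
  linarith

section LFunction

open UniqueFactorizationMonoid

variable {k : Type*} [Field k] [Finite k]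

theorem finite_monic_natDegree (n : ℕ) :
    {g : k[X] | g.Monic ∧ g.natDegree = n}.Finite := by
  have : Finite (degreeLT k (n + 1)) := Finite.of_equiv _ (degreeLTEquiv k (n + 1)).toEquiv.symm
  refine Set.Finite.subset (Set.toFinite (degreeLT k (n + 1) : Set k[X])) ?_
  rintro g ⟨-, hg⟩
  rw [SetLike.mem_coe, mem_degreeLT]
  exact lt_of_le_of_lt degree_le_natDegree (by rw [hg]; exact_mod_cast Nat.lt_succ_self n)

/-- The monic polynomials of degree `n` over a finite field. -/
noncomputable def monicsOfDegree (k : Type*) [Field k] [Finite k] (n : ℕ) : Finset k[X] :=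
  (finite_monic_natDegree (k := k) n).toFinset

theorem mem_monicsOfDegree {n : ℕ} {g : k[X]} :
    g ∈ monicsOfDegree k n ↔ g.Monic ∧ g.natDegree = n := by
  simp [monicsOfDegree]

open Classical in
/-- The monic irreducible polynomials of degree at most `n` over a finite field. -/
noncomputable def monicIrreducibles (k : Type*) [Field k] [Finite k] (n : ℕ) : Finset k[X] :=
  ((Finset.range (n + 1)).biUnion (monicsOfDegree k)).filter Irreducible

theorem mem_monicIrreducibles {n : ℕ} {g : k[X]} :
    g ∈ monicIrreducibles k n ↔ g.Monic ∧ g.natDegree ≤ n ∧ Irreducible g := by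
  simp only [monicIrreducibles, Finset.mem_filter, Finset.mem_biUnion, Finset.mem_range,
    mem_monicsOfDegree]
  constructor
  · rintro ⟨⟨a, ha, hg, rfl⟩, hi⟩
    exact ⟨hg, by omega, hi⟩
  · rintro ⟨h1, h2, h3⟩
    exact ⟨⟨_, by omega, h1, rfl⟩, h3⟩

/-- The `n`-th coefficient of the `L`-function of a multiplicative function on polynomials. -/
noncomputable def lCoeff (ψ : k[X] →* ℂ) (n : ℕ) : ℂ := ∑ g ∈ monicsOfDegree k n, ψ g

/-- The `n`-th coefficient of the logarithmic derivative of the `L`-function. -/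
noncomputable def lPowerSum (ψ : k[X] →* ℂ) (n : ℕ) : ℂ :=
  ∑ P ∈ (monicIrreducibles k n).filter (fun P => P.natDegree ∣ n),
    (P.natDegree : ℂ) * ψ P ^ (n / P.natDegree)

open Classical in
theorem natDegree_eq_sum_dvd {n : ℕ} {g : k[X]} (hg : g.Monic) (hn : g.natDegree = n) :
    n = ∑ P ∈ monicIrreducibles k n, ∑ i ∈ Finset.Icc 1 n,
      if P ^ i ∣ g then P.natDegree else 0 := by
  have hg0 := hg.ne_zero
  have hmonic : ∀ P ∈ normalizedFactors g, P.Monic := fun P hP => by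
    have h0 : P ≠ 0 := (irreducible_of_normalized_factor P hP).ne_zero
    have := normalize_normalized_factor P hP
    rw [← this]; exact Polynomial.monic_normalize h0
  have hprod : (normalizedFactors g).prod = g := by
    rw [prod_normalizedFactors_eq hg0, hg.normalize_eq_self]
  have hsub : (normalizedFactors g).toFinset ⊆ monicIrreducibles k n := by
    intro P hP
    rw [Multiset.mem_toFinset] at hP
    refine mem_monicIrreducibles.2 ⟨hmonic P hP, ?_, irreducible_of_normalized_factor P hP⟩
    rw [← hn]
    exact natDegree_le_of_dvd (dvd_of_mem_normalizedFactors hP) hg0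
  have h1 : n = ∑ P ∈ (normalizedFactors g).toFinset,
      (normalizedFactors g).count P * P.natDegree := by
    rw [← hn]
    conv_lhs => rw [← hprod]
    rw [natDegree_multiset_prod_of_monic _ hmonic, Finset.sum_multiset_map_count]
    simp
  have h2 : ∀ P ∈ monicIrreducibles k n, (∑ i ∈ Finset.Icc 1 n,
      if P ^ i ∣ g then P.natDegree else 0) = (normalizedFactors g).count P * P.natDegree := by
    intro P hP
    obtain ⟨hPm, -, hPi⟩ := mem_monicIrreducibles.1 hP
    rw [← Finset.sum_filter, Finset.sum_const, smul_eq_mul]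
    congr 1
    have hiff : ∀ i : ℕ, P ^ i ∣ g ↔ i ≤ (normalizedFactors g).count P := by
      intro i
      rw [pow_dvd_iff_le_emultiplicity, emultiplicity_eq_count_normalizedFactors hPi hg0,
        hPm.normalize_eq_self]
      exact_mod_cast Iff.rfl
    have hle : (normalizedFactors g).count P ≤ n := by
      have h3 := natDegree_le_of_dvd ((hiff _).2 le_rfl) hg0
      rw [natDegree_pow, hn] at h3
      have := hPi.natDegree_pos
      nlinarith
    have : (Finset.Icc 1 n).filter (fun i => P ^ i ∣ g) =
        Finset.Icc 1 ((normalizedFactors g).count P) := by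
      ext i
      simp only [Finset.mem_filter, Finset.mem_Icc, hiff]
      omega
    rw [this, Nat.card_Icc, Nat.add_sub_cancel]
  rw [Finset.sum_congr rfl h2]
  conv_lhs => rw [h1]
  refine Finset.sum_subset hsub fun P _ hP => ?_
  rw [Multiset.mem_toFinset] at hP
  rw [Multiset.count_eq_zero_of_notMem hP, zero_mul]

open Classical in
theorem sum_monics_dvd (ψ : k[X] →* ℂ) {n m : ℕ} {P : k[X]} (hP : P.Monic)
    (hm : P.natDegree = m) :
    ∑ g ∈ (monicsOfDegree k n).filter (fun g => P ∣ g), ψ g =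
      if m ≤ n then ψ P * lCoeff ψ (n - m) else 0 := by
  split_ifs with h
  · rw [lCoeff, Finset.mul_sum]
    symm
    refine Finset.sum_bij (fun h _ => P * h) ?_ ?_ ?_ ?_
    · intro q hq
      rw [mem_monicsOfDegree] at hq
      rw [Finset.mem_filter, mem_monicsOfDegree]
      refine ⟨⟨hP.mul hq.1, ?_⟩, dvd_mul_right _ _⟩
      rw [hP.natDegree_mul hq.1, hm, hq.2]; omega
    · intro q _ r _ hqr
      exact mul_left_cancel₀ hP.ne_zero hqr
    · intro g hg
      rw [Finset.mem_filter, mem_monicsOfDegree] at hg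
      obtain ⟨⟨hg1, hg2⟩, q, rfl⟩ := hg
      have hq := hP.of_mul_monic_left hg1
      refine ⟨q, ?_, rfl⟩
      rw [mem_monicsOfDegree]
      refine ⟨hq, ?_⟩
      rw [hP.natDegree_mul hq, hm] at hg2
      omega
    · intro q _
      rw [map_mul]
  · rw [Finset.filter_false_of_mem, Finset.sum_empty]
    intro g hg hPg
    rw [mem_monicsOfDegree] at hg
    have := natDegree_le_of_dvd hPg hg.1.ne_zero
    omega

/-- Newton's identities relating the coefficients of the `L`-function to those of its
logarithmic derivative. -/
theorem lCoeff_newton (ψ : k[X] →* ℂ) (n : ℕ) :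
    (n : ℂ) * lCoeff ψ n = ∑ j ∈ Finset.Icc 1 n, lPowerSum ψ j * lCoeff ψ (n - j) := by
  classical
  have h1 : (n : ℂ) * lCoeff ψ n = ∑ P ∈ monicIrreducibles k n, ∑ i ∈ Finset.Icc 1 n,
      (P.natDegree : ℂ) * ∑ g ∈ (monicsOfDegree k n).filter (fun g => P ^ i ∣ g), ψ g := by
    rw [lCoeff, Finset.mul_sum]
    have : ∀ g ∈ monicsOfDegree k n, (n : ℂ) * ψ g =
        ∑ P ∈ monicIrreducibles k n, ∑ i ∈ Finset.Icc 1 n,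
          if P ^ i ∣ g then (P.natDegree : ℂ) * ψ g else 0 := by
      intro g hg
      obtain ⟨hg1, hg2⟩ := mem_monicsOfDegree.1 hg
      have h := congrArg (Nat.cast : ℕ → ℂ) (natDegree_eq_sum_dvd hg1 hg2)
      push_cast at h
      conv_lhs => rw [h]
      simp only [Finset.sum_mul, ite_mul, zero_mul]
    rw [Finset.sum_congr rfl this, Finset.sum_comm]
    refine Finset.sum_congr rfl fun P _ => ?_
    rw [Finset.sum_comm]
    refine Finset.sum_congr rfl fun i _ => ?_
    rw [Finset.mul_sum, Finset.sum_filter]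
  rw [h1]
  have h2 : ∀ P ∈ monicIrreducibles k n, (∑ i ∈ Finset.Icc 1 n,
      (P.natDegree : ℂ) * ∑ g ∈ (monicsOfDegree k n).filter (fun g => P ^ i ∣ g), ψ g) =
      ∑ j ∈ Finset.Icc 1 n, if P.natDegree ∣ j then
        (P.natDegree : ℂ) * ψ P ^ (j / P.natDegree) * lCoeff ψ (n - j) else 0 := by
    intro P hP
    obtain ⟨hPm, -, hPi⟩ := mem_monicIrreducibles.1 hP
    have hpos := hPi.natDegree_pos
    have h3 : ∀ i ∈ Finset.Icc 1 n, ((P.natDegree : ℂ) *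
        ∑ g ∈ (monicsOfDegree k n).filter (fun g => P ^ i ∣ g), ψ g) =
        if i * P.natDegree ≤ n then
          (P.natDegree : ℂ) * ψ P ^ i * lCoeff ψ (n - i * P.natDegree) else 0 := by
      intro i _
      rw [sum_monics_dvd ψ (hPm.pow i) (by rw [natDegree_pow])]
      split_ifs
      · rw [map_pow, mul_assoc]
      · rw [mul_zero]
    rw [Finset.sum_congr rfl h3, ← Finset.sum_filter, ← Finset.sum_filter]
    refine Finset.sum_nbij' (fun i => i * P.natDegree) (fun j => j / P.natDegree) ?_ ?_ ?_ ?_ ?_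
    · intro i hi
      simp only [Finset.mem_filter, Finset.mem_Icc] at hi ⊢
      exact ⟨⟨Nat.mul_pos (by omega) hpos, hi.2⟩, dvd_mul_left _ _⟩
    · intro j hj
      simp only [Finset.mem_filter, Finset.mem_Icc] at hj ⊢
      obtain ⟨⟨hj1, hj2⟩, i, rfl⟩ := hj
      rw [Nat.mul_div_cancel_left _ hpos, mul_comm]
      refine ⟨⟨Nat.pos_of_ne_zero ?_, ?_⟩, hj2⟩
      · rintro rfl; simp at hj1
      · nlinarith
    · intro i _
      exact Nat.mul_div_cancel _ hpos
    · intro j hj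
      simp only [Finset.mem_filter] at hj
      exact Nat.div_mul_cancel hj.2
    · intro i _
      rw [Nat.mul_div_cancel _ hpos]
  rw [Finset.sum_congr rfl h2, Finset.sum_comm]
  refine Finset.sum_congr rfl fun j hj => ?_
  rw [Finset.mem_Icc] at hj
  rw [← Finset.sum_filter, lPowerSum, Finset.sum_mul]
  refine Finset.sum_congr ?_ fun P _ => rfl
  ext P
  simp only [Finset.mem_filter, mem_monicIrreducibles]
  constructor
  · rintro ⟨⟨a, b, c⟩, d⟩
    exact ⟨⟨a, Nat.le_of_dvd (by omega) d, c⟩, d⟩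
  · rintro ⟨⟨a, b, c⟩, d⟩
    exact ⟨⟨a, by omega, c⟩, d⟩

theorem lCoeff_zero (ψ : k[X] →* ℂ) : lCoeff ψ 0 = 1 := by
  have : monicsOfDegree k 0 = {1} := by
    ext g
    rw [mem_monicsOfDegree, Finset.mem_singleton]
    constructor
    · rintro ⟨h1, h2⟩
      exact eq_one_of_monic_natDegree_zero h1 h2
    · rintro rfl; simp
  rw [lCoeff, this, Finset.sum_singleton, map_one]

/-- If the `L`-function is a polynomial of degree at most two, then its logarithmic derivative
is given by power sums of two complex numbers. -/
theorem exists_powerSum {ψ : k[X] →* ℂ} (h : ∀ n, 3 ≤ n → lCoeff ψ n = 0) :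
    ∃ z w : ℂ, ∀ n, 1 ≤ n → lPowerSum ψ n = -(z ^ n + w ^ n) := by
  set c₁ := lCoeff ψ 1 with hc₁
  set c₂ := lCoeff ψ 2 with hc₂
  obtain ⟨s, hs⟩ := IsAlgClosed.exists_pow_nat_eq (c₁ ^ 2 - 4 * c₂) (n := 2) (by norm_num)
  obtain ⟨z, hz⟩ : ∃ z, z = (-c₁ + s) / 2 := ⟨_, rfl⟩
  obtain ⟨w, hw⟩ : ∃ w, w = (-c₁ - s) / 2 := ⟨_, rfl⟩
  have hsum : z + w = -c₁ := by rw [hz, hw]; ring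
  have hprod : z * w = c₂ := by rw [hz, hw]; linear_combination (-1 / 4 : ℂ) * hs
  have e1 : lPowerSum ψ 1 = c₁ := by
    have := lCoeff_newton ψ 1
    simp [lCoeff_zero] at this
    rw [hc₁, this]
  have e2 : lPowerSum ψ 2 = 2 * c₂ - c₁ * c₁ := by
    have := lCoeff_newton ψ 2
    rw [Finset.sum_Icc_succ_top (by norm_num)] at this
    simp [lCoeff_zero] at this
    rw [e1] at this
    linear_combination -this
  have hrec : ∀ n, lPowerSum ψ (n + 3) =
      -(c₁ * lPowerSum ψ (n + 2) + c₂ * lPowerSum ψ (n + 1)) := by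
    intro n
    have := lCoeff_newton ψ (n + 3)
    rw [h _ (by omega), mul_zero, Finset.sum_Icc_succ_top (by omega),
      Finset.sum_Icc_succ_top (by omega), Finset.sum_Icc_succ_top (by omega),
      Finset.sum_eq_zero] at this
    · rw [show n + 3 - (n + 2 + 1) = 0 by omega, show n + 3 - (n + 1 + 1) = 1 by omega,
        show n + 3 - (n + 1) = 2 by omega, lCoeff_zero] at this
      linear_combination -this
    · intro j hj
      rw [Finset.mem_Icc] at hj
      rw [h _ (by omega), mul_zero]
  refine ⟨z, w, ?_⟩
  have key : ∀ n, lPowerSum ψ (n + 1) = -(z ^ (n + 1) + w ^ (n + 1)) ∧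
      lPowerSum ψ (n + 2) = -(z ^ (n + 2) + w ^ (n + 2)) := by
    intro n
    induction n with
    | zero =>
      refine ⟨?_, ?_⟩
      · rw [e1]; linear_combination hsum
      · rw [e2]; linear_combination (-2 : ℂ) * hprod + (z + w - c₁) * hsum
    | succ n ih =>
      refine ⟨ih.2, ?_⟩
      rw [show n + 1 + 2 = n + 3 by ring, hrec, ih.1, ih.2, ← hprod]
      have : c₁ = -(z + w) := by rw [hsum]; ring
      rw [this]
      ring
  intro n hn
  obtain ⟨m, rfl⟩ : ∃ m, n = m + 1 := ⟨n - 1, by omega⟩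
  exact (key m).1

end LFunction

open IntermediateField in
theorem norm_algebraMap_sub {k K : Type*} [Field k] [Field K] [Algebra k K] [FiniteDimensional k K]
    (r : k) (x : K) :
    Algebra.norm k (algebraMap k K r - x) =
      (minpoly k x).eval r ^ (Module.finrank k K / (minpoly k x).natDegree) := by
  have hx : IsIntegral k x := IsIntegral.of_finite k x
  have h1 : algebraMap k K r - x =
      algebraMap k⟮x⟯ K (algebraMap k k⟮x⟯ r - AdjoinSimple.gen k x) := by
    rw [map_sub, AdjoinSimple.algebraMap_gen, ← IsScalarTower.algebraMap_apply]
  have h2 : Algebra.norm k (algebraMap k k⟮x⟯ r - AdjoinSimple.gen k x) =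
      (minpoly k x).eval r := by
    have h3 := charpoly_leftMulMatrix (adjoin.powerBasis hx)
    have h4 : minpoly k (adjoin.powerBasis hx).gen = minpoly k x := by
      rw [adjoin.powerBasis_gen, minpoly_gen]
    rw [← h4, ← h3, Matrix.eval_charpoly, Algebra.norm_eq_matrix_det (adjoin.powerBasis hx).basis,
      map_sub, adjoin.powerBasis_gen]
    congr 2
    rw [AlgHom.commutes]
    rfl
  have h5 : Module.finrank k K / (minpoly k x).natDegree = Module.finrank k⟮x⟯ K := by
    rw [← adjoin.finrank hx, ← Module.finrank_mul_finrank k k⟮x⟯ K]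
    exact Nat.mul_div_cancel_left _ Module.finrank_pos
  rw [h1, ← Algebra.norm_norm (S := k⟮x⟯), Algebra.norm_algebraMap, map_pow, h2, h5]

theorem lPowerSum_eq_sum {k : Type*} [Field k] [Finite k] (ψ : k[X] →* ℂ) (K : Type*) [Field K]
    [Fintype K] [Algebra k K] :
    lPowerSum ψ (Module.finrank k K) =
      ∑ x : K, ψ (minpoly k x) ^ (Module.finrank k K / (minpoly k x).natDegree) := by
  classical
  set n := Module.finrank k K with hn
  have hn0 : 0 < n := Module.finrank_pos
  rw [← Finset.sum_fiberwise_of_maps_to (s := Finset.univ) (g := fun x : K => minpoly k x)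
    (t := (monicIrreducibles k n).filter (fun P => P.natDegree ∣ n)), lPowerSum]
  · refine Finset.sum_congr rfl fun P hP => ?_
    rw [Finset.mem_filter, mem_monicIrreducibles] at hP
    obtain ⟨⟨hPm, -, hPi⟩, hPn⟩ := hP
    rw [Finset.sum_congr rfl (g := fun _ => ψ P ^ (n / P.natDegree)) (by
      intro x hx; rw [(Finset.mem_filter.1 hx).2]), Finset.sum_const, nsmul_eq_mul]
    congr 2
    have hcardK : Fintype.card K = Nat.card k ^ n := by
      rw [hn, ← Module.natCard_eq_pow_finrank, Nat.card_eq_fintype_card]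
    have hdvd := (hPi.natDegree_dvd_iff_dvd_X_pow_card_pow_sub_X (n := n)).1 hPn
    have hsplit : (P.map (algebraMap k K)).Splits := by
      rw [← hcardK] at hdvd
      refine Splits.of_dvd (FiniteField.isSplittingField_sub K k).splits ?_
        (map_dvd (mapRingHom (algebraMap k K)) hdvd)
      rw [hcardK]
      exact map_ne_zero (FiniteField.X_pow_card_pow_sub_X_ne_zero _ hn0.ne' Finite.one_lt_card)
    have hsep : P.Separable := PerfectField.separable_of_irreducible hPi
    rw [← card_rootSet_eq_natDegree (K := K) hsep hsplit, ← Set.toFinset_card]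
    congr 1
    ext x
    rw [Set.mem_toFinset, mem_rootSet_of_ne hPm.ne_zero, Finset.mem_filter]
    constructor
    · intro h
      exact ⟨Finset.mem_univ _, (minpoly.eq_of_irreducible_of_monic hPi h hPm).symm⟩
    · rintro ⟨-, rfl⟩
      exact minpoly.aeval _ _
  · intro x _
    have hx : IsIntegral k x := IsIntegral.of_finite k x
    rw [Finset.mem_filter, mem_monicIrreducibles]
    have hd : (minpoly k x).natDegree ∣ n := minpoly.degree_dvd hx
    exact ⟨⟨minpoly.monic hx, Nat.le_of_dvd hn0 hd, minpoly.irreducible hx⟩, hd⟩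

/-- If the power sums `z ^ n + w ^ n` are bounded then `z` and `w` lie in the unit disc. -/
theorem norm_le_one_of_powerSum_bounded {z w : ℂ} {C : ℝ} {n₀ : ℕ}
    (h : ∀ n, n₀ ≤ n → ‖z ^ n + w ^ n‖ ≤ C) : ‖z‖ ≤ 1 ∧ ‖w‖ ≤ 1 := by
  have hbdd : ∀ {x D : ℝ}, 0 ≤ x → (∀ n, n₀ ≤ n → x ^ n ≤ D) → x ≤ 1 := by
    intro x D hx hD
    by_contra! h1
    obtain ⟨n, hn⟩ := pow_unbounded_of_one_lt D h1
    have := hD (max n n₀) (le_max_right _ _)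
    have h2 := pow_le_pow_right₀ h1.le (le_max_left n n₀)
    linarith
  have hprod : ‖z‖ * ‖w‖ ≤ 1 := by
    refine hbdd (D := (C ^ 2 + C) / 2) (by positivity) fun n hn => ?_
    have h1 := h n hn
    have h2 := h (2 * n) (by omega)
    have h3 : 2 * (z * w) ^ n = (z ^ n + w ^ n) ^ 2 - (z ^ (2 * n) + w ^ (2 * n)) := by
      rw [mul_pow, pow_mul', pow_mul']; ring
    have h4 : 2 * (‖z‖ * ‖w‖) ^ n ≤ C ^ 2 + C := by
      calc 2 * (‖z‖ * ‖w‖) ^ n = ‖2 * (z * w) ^ n‖ := by simp [norm_pow]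
        _ ≤ ‖(z ^ n + w ^ n) ^ 2‖ + ‖z ^ (2 * n) + w ^ (2 * n)‖ := by rw [h3]; exact norm_sub_le _ _
        _ ≤ C ^ 2 + C := by
          rw [norm_pow]
          gcongr
    linarith
  have hmain : ∀ {z w : ℂ}, (∀ n, n₀ ≤ n → ‖z ^ n + w ^ n‖ ≤ C) → ‖z‖ * ‖w‖ ≤ 1 → ‖z‖ ≤ 1 := by
    intro z w h hzw
    by_contra! h1
    have hw : ‖w‖ ≤ 1 := by nlinarith [norm_nonneg w]
    refine absurd (hbdd (D := C + 1) (norm_nonneg z) fun n hn => ?_) (not_le.2 h1)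
    rw [← norm_pow]
    calc ‖z ^ n‖ = ‖(z ^ n + w ^ n) - w ^ n‖ := by rw [add_sub_cancel_right]
      _ ≤ ‖z ^ n + w ^ n‖ + ‖w ^ n‖ := norm_sub_le _ _
      _ ≤ C + 1 := add_le_add (h n hn) (by rw [norm_pow]; exact pow_le_one₀ (norm_nonneg _) hw)
  exact ⟨hmain h hprod, hmain (fun n hn => by rw [add_comm]; exact h n hn) (by rwa [mul_comm])⟩

section Weil

variable {p : ℕ} [Fact p.Prime]

/-- The multiplicative function `g ↦ χ (g(r₁) g(r₂) g(r₃) ^ (p - 2))` on polynomials. -/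
noncomputable def charEval (χ : MulChar (ZMod p) ℂ) (r₁ r₂ r₃ : ZMod p) : (ZMod p)[X] →* ℂ where
  toFun g := χ (g.eval r₁ * g.eval r₂ * g.eval r₃ ^ (p - 2))
  map_one' := by simp
  map_mul' g h := by
    rw [← map_mul]
    congr 1
    simp only [eval_mul, mul_pow]
    ring

theorem charEval_apply (χ : MulChar (ZMod p) ℂ) (r₁ r₂ r₃ : ZMod p) (g : (ZMod p)[X]) :
    charEval χ r₁ r₂ r₃ g = χ (g.eval r₁ * g.eval r₂ * g.eval r₃ ^ (p - 2)) := rfl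

theorem mulChar_pow_sub_two_ne_one (hp : 3 ≤ p) {χ : MulChar (ZMod p) ℂ} (hχ : χ ≠ 1) :
    χ ^ (p - 2) ≠ 1 := by
  intro h
  have h1 : χ ^ (p - 1) = 1 := by
    have := MulChar.pow_card_eq_one χ
    rwa [ZMod.card_units] at this
  apply hχ
  have h2 : p - 1 = (p - 2) + 1 := by omega
  rwa [h2, pow_succ, h, one_mul] at h1

theorem sum_char_affine_pow (hp : 3 ≤ p) {χ : MulChar (ZMod p) ℂ} (hχ : χ ≠ 1)
    (u : ZMod p) {v : ZMod p} (hv : v ≠ 0) : ∑ t, χ ((u + t * v) ^ (p - 2)) = 0 := by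
  have h1 : ∀ y, χ (y ^ (p - 2)) = (χ ^ (p - 2)) y := by
    intro y
    rw [MulChar.pow_apply' _ (by omega), map_pow]
  simp only [h1]
  rw [← MulChar.sum_eq_zero_of_ne_one (mulChar_pow_sub_two_ne_one hp hχ)]
  exact Fintype.sum_bijective (fun t => u + t * v)
    ((AddGroup.addLeft_bijective u).comp (mulRight_bijective₀ v hv)) _ _ fun _ => rfl

theorem lCoeff_charEval_eq_zero (hp : 3 ≤ p) {χ : MulChar (ZMod p) ℂ} (hχ : χ ≠ 1)
    {r₁ r₂ r₃ : ZMod p} (h₁ : r₃ ≠ r₁) (h₂ : r₃ ≠ r₂) {n : ℕ} (hn : 3 ≤ n) :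
    lCoeff (charEval χ r₁ r₂ r₃) n = 0 := by
  set q : (ZMod p)[X] := (X - C r₁) * (X - C r₂) with hq
  have hqd : q.natDegree = 2 := by
    rw [hq, natDegree_mul (X_sub_C_ne_zero _) (X_sub_C_ne_zero _)]; simp
  have hmem : ∀ t : ZMod p, ∀ g ∈ monicsOfDegree (ZMod p) n,
      g + C t * q ∈ monicsOfDegree (ZMod p) n := by
    intro t g hg
    rw [mem_monicsOfDegree] at hg ⊢
    have hlt : (C t * q).degree < g.degree := by
      refine lt_of_le_of_lt degree_le_natDegree ?_
      rw [degree_eq_natDegree hg.1.ne_zero, hg.2]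
      have : (C t * q).natDegree ≤ 2 := (natDegree_C_mul_le _ _).trans hqd.le
      exact_mod_cast (by omega : (C t * q).natDegree < n)
    refine ⟨hg.1.add_of_left hlt, ?_⟩
    rw [natDegree_eq_of_degree_eq (degree_add_eq_left_of_degree_lt hlt), hg.2]
  have hshift : ∀ t : ZMod p, lCoeff (charEval χ r₁ r₂ r₃) n =
      ∑ g ∈ monicsOfDegree (ZMod p) n, charEval χ r₁ r₂ r₃ (g + C t * q) := by
    intro t
    symm
    refine Finset.sum_nbij' (fun g => g + C t * q) (fun g => g + C (-t) * q) (hmem t) (hmem (-t))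
      ?_ ?_ (fun _ _ => rfl)
    · intro g _; simp
    · intro g _; simp
  have hsum : (p : ℂ) * lCoeff (charEval χ r₁ r₂ r₃) n = 0 := by
    calc (p : ℂ) * lCoeff (charEval χ r₁ r₂ r₃) n
        = ∑ t : ZMod p, lCoeff (charEval χ r₁ r₂ r₃) n := by
          rw [Finset.sum_const, Finset.card_univ, ZMod.card, nsmul_eq_mul]
      _ = ∑ g ∈ monicsOfDegree (ZMod p) n, ∑ t : ZMod p, charEval χ r₁ r₂ r₃ (g + C t * q) := by
          rw [Finset.sum_comm]
          exact Finset.sum_congr rfl fun t _ => hshift t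
      _ = 0 := by
          refine Finset.sum_eq_zero fun g _ => ?_
          have : ∀ t : ZMod p, charEval χ r₁ r₂ r₃ (g + C t * q) =
              χ (g.eval r₁ * g.eval r₂) *
                χ ((g.eval r₃ + t * ((r₃ - r₁) * (r₃ - r₂))) ^ (p - 2)) := by
            intro t
            rw [charEval_apply, ← map_mul]
            simp [hq]
          simp only [this]
          rw [← Finset.mul_sum, sum_char_affine_pow hp hχ _
            (mul_ne_zero (sub_ne_zero.2 h₁) (sub_ne_zero.2 h₂)), mul_zero]
  exact (mul_eq_zero.1 hsum).resolve_left (by exact_mod_cast (Fact.out : p.Prime).ne_zero)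

theorem lPowerSum_charEval (χ : MulChar (ZMod p) ℂ) (r₁ r₂ r₃ : ZMod p) (K : Type*) [Field K]
    [Fintype K] [Algebra (ZMod p) K] :
    lPowerSum (charEval χ r₁ r₂ r₃) (Module.finrank (ZMod p) K) =
      ∑ x : K, χ (Algebra.norm (ZMod p)
        (aeval x ((C r₁ - X) * (C r₂ - X) * (C r₃ - X) ^ (p - 2) : (ZMod p)[X]))) := by
  rw [lPowerSum_eq_sum]
  refine Finset.sum_congr rfl fun x _ => ?_
  simp only [map_mul, map_pow, map_sub, aeval_C, aeval_X, norm_algebraMap_sub, charEval_apply]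
  ring

/-- The Weil bound for the sums of `χ ((x - r₁) (x - r₂) / (x - r₃))`. -/
theorem weil_bound (hp : 3 ≤ p) {χ : MulChar (ZMod p) ℂ} (hχ : χ ≠ 1)
    {r₁ r₂ r₃ : ZMod p} (h₁ : r₃ ≠ r₁) (h₂ : r₃ ≠ r₂) :
    ‖∑ x, χ ((r₁ - x) * (r₂ - x) * (r₃ - x) ^ (p - 2))‖ ≤ 2 * √p := by
  obtain ⟨z, w, hzw⟩ := exists_powerSum
    (fun n hn => lCoeff_charEval_eq_zero hp hχ h₁ h₂ hn)
  set f : (ZMod p)[X] := (C r₁ - X) * (C r₂ - X) * (C r₃ - X) ^ (p - 2) with hf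
  have hfd : f.natDegree = p := by
    have hd : ∀ r : ZMod p, (C r - X).natDegree = 1 := by
      intro r; rw [natDegree_sub, natDegree_X_sub_C]
    have h0 : ∀ r : ZMod p, (C r - X) ≠ 0 := by
      intro r h; have := hd r; rw [h] at this; simp at this
    rw [hf, natDegree_mul (mul_ne_zero (h0 _) (h0 _)) (pow_ne_zero _ (h0 _)),
      natDegree_mul (h0 _) (h0 _), natDegree_pow, hd, hd, hd]
    omega
  have hp0 : (0 : ℝ) < p := by exact_mod_cast (by omega : 0 < p)
  have hbound : ∀ μ, 9 ≤ μ → ‖(z ^ 2 / p) ^ μ + (w ^ 2 / p) ^ μ‖ ≤ 4 * p ^ 2 + 8 * p := by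
    intro μ hμ
    let := Fintype.ofFinite (GaloisField p (2 * μ))
    have hcard : Fintype.card (GaloisField p (2 * μ)) = (p ^ μ) ^ 2 := by
      rw [← Nat.card_eq_fintype_card, GaloisField.card _ _ (by omega)]; ring
    have h3 := norm_sum_char_norm_le (GaloisField p (2 * μ)) hμ hcard hfd hχ
    rw [← lPowerSum_charEval, GaloisField.finrank _ (by omega), hzw _ (by omega), norm_neg] at h3
    have h4 : (z ^ 2 / p) ^ μ + (w ^ 2 / p) ^ μ = (z ^ (2 * μ) + w ^ (2 * μ)) / (p : ℂ) ^ μ := by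
      rw [div_pow, div_pow, ← pow_mul, ← pow_mul]; ring
    rw [h4, norm_div, norm_pow, Complex.norm_natCast, div_le_iff₀ (by positivity)]
    exact h3
  obtain ⟨hz, hw⟩ := norm_le_one_of_powerSum_bounded hbound
  have hsq : ∀ {y : ℂ}, ‖y ^ 2 / (p : ℂ)‖ ≤ 1 → ‖y‖ ≤ √p := by
    intro y hy
    rw [norm_div, norm_pow, Complex.norm_natCast, div_le_one hp0] at hy
    exact Real.le_sqrt_of_sq_le hy
  have h1 := hzw 1 le_rfl
  have h2 := lPowerSum_charEval χ r₁ r₂ r₃ (ZMod p)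
  rw [Module.finrank_self, h1] at h2
  have h3 : ∑ x, χ ((r₁ - x) * (r₂ - x) * (r₃ - x) ^ (p - 2)) = -(z ^ 1 + w ^ 1) := by
    rw [h2]
    refine Finset.sum_congr rfl fun x _ => ?_
    rw [Algebra.norm_self]
    simp
  rw [h3, norm_neg, pow_one, pow_one, two_mul]
  exact (norm_add_le _ _).trans (add_le_add (hsq hz) (hsq hw))

end Weil

end WeilBound

section FourthMoment

variable {p : ℕ}

theorem norm_char_le_one (χ : MulChar (ZMod p) ℂ) (a : ZMod p) : ‖χ a‖ ≤ 1 :=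
  DirichletCharacter.norm_le_one χ a

variable [Fact p.Prime]

theorem zmod_inv_eq_pow (hp : 3 ≤ p) (y : ZMod p) : y⁻¹ = y ^ (p - 2) := by
  by_cases hy : y = 0
  · rw [hy, inv_zero, zero_pow (by omega)]
  · refine inv_eq_of_mul_eq_one_right ?_
    rw [← pow_succ', show p - 2 + 1 = p - 1 by omega]
    exact ZMod.pow_card_sub_one_eq_one hy

theorem conj_char (χ : MulChar (ZMod p) ℂ) (a : ZMod p) :
    (starRingEnd ℂ) (χ a) = χ a⁻¹ := by
  rw [← MulChar.inv_apply', ← MulChar.star_eq_inv, MulChar.star_apply]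
  rfl

/-- Summation over the field after the substitution `x = u⁻¹ - d`. -/
theorem sum_inv_sub {f g : ZMod p → ℂ} (d : ZMod p) (h0 : f (-d) = 0)
    (h : ∀ u, u ≠ 0 → f (u⁻¹ - d) = g u) : ∑ x, f x = ∑ u, g u - g 0 := by
  have e : ∑ x, f x = ∑ u, f (u⁻¹ - d) :=
    (Fintype.sum_equiv ((Equiv.inv (ZMod p)).trans (Equiv.subRight d)) _ _ (fun _ => rfl)).symm
  rw [e, ← Finset.add_sum_erase _ _ (Finset.mem_univ 0),
    ← Finset.add_sum_erase Finset.univ g (Finset.mem_univ 0), inv_zero, zero_sub, h0, zero_add,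
    add_sub_cancel_left]
  exact Finset.sum_congr rfl fun u hu => h u (Finset.ne_of_mem_erase hu)

/-- Affine nontrivial character sums vanish. -/
theorem sum_char_affine {χ : MulChar (ZMod p) ℂ} (hχ : χ ≠ 1) {α : ZMod p} (hα : α ≠ 0) :
    ∑ u, χ (1 + α * u) = 0 := by
  rw [← MulChar.sum_eq_zero_of_ne_one hχ]
  exact Fintype.sum_equiv ((Equiv.mulLeft₀ α hα).trans (Equiv.addLeft 1)) _ _ (fun _ => rfl)

theorem norm_sum_char_two_le {χ : MulChar (ZMod p) ℂ} (hχ : χ ≠ 1) {b d : ZMod p}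
    (h : b ≠ d) : ‖∑ x, χ ((x + b) * (x + d)⁻¹)‖ ≤ 1 := by
  rw [sum_inv_sub (g := fun u => χ (1 + (b - d) * u)) d (by simp [MulChar.map_zero]),
    sum_char_affine hχ (sub_ne_zero.2 h)]
  · simp
  · intro u hu
    congr 1
    field_simp
    ring

theorem norm_sum_char_four_le_of_eq {χ : MulChar (ZMod p) ℂ} (hχ : χ ≠ 1) {a b d : ZMod p}
    (h : b ≠ d) :
    ‖∑ x, χ ((x + a) * (x + b) * (x + a)⁻¹ * (x + d)⁻¹)‖ ≤ 2 := by
  have e : ∑ x, χ ((x + a) * (x + b) * (x + a)⁻¹ * (x + d)⁻¹) =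
      ∑ x, χ ((x + b) * (x + d)⁻¹) - χ ((-a + b) * (-a + d)⁻¹) := by
    rw [← Finset.add_sum_erase _ _ (Finset.mem_univ (-a)),
      ← Finset.add_sum_erase _ (fun x => χ ((x + b) * (x + d)⁻¹)) (Finset.mem_univ (-a))]
    simp only [neg_add_cancel, zero_mul, MulChar.map_zero, zero_add, add_sub_cancel_left]
    refine Finset.sum_congr rfl fun x hx => ?_
    have : x + a ≠ 0 := fun h => Finset.ne_of_mem_erase hx (eq_neg_of_add_eq_zero_left h)
    congr 1
    field_simp
  rw [e]
  refine (norm_sub_le _ _).trans ?_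
  linarith [norm_sum_char_two_le hχ h, norm_char_le_one χ ((-a + b) * (-a + d)⁻¹)]

theorem norm_sum_char_four_le_of_ne (hp : 3 ≤ p) {χ : MulChar (ZMod p) ℂ} (hχ : χ ≠ 1)
    {a b c d : ZMod p} (hac : a ≠ c) (had : a ≠ d) (hbc : b ≠ c) (hbd : b ≠ d) (hcd : c ≠ d) :
    ‖∑ x, χ ((x + a) * (x + b) * (x + c)⁻¹ * (x + d)⁻¹)‖ ≤ 2 * √p + 1 := by
  have hα := sub_ne_zero.2 had
  have hβ := sub_ne_zero.2 hbd
  have hγ := sub_ne_zero.2 hcd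
  rw [sum_inv_sub (g := fun u => χ ((1 + (a - d) * u) * (1 + (b - d) * u) *
    (1 + (c - d) * u)⁻¹)) d (by simp [MulChar.map_zero])]
  · refine (norm_sub_le _ _).trans (add_le_add ?_ (norm_char_le_one _ _))
    have e : ∀ u, χ ((1 + (a - d) * u) * (1 + (b - d) * u) * (1 + (c - d) * u)⁻¹) =
        χ ((a - d) * (b - d) * -(c - d)⁻¹) * χ ((-(a - d)⁻¹ - u) * (-(b - d)⁻¹ - u) *
          (-(c - d)⁻¹ - u) ^ (p - 2)) := by
      intro u
      rw [← zmod_inv_eq_pow hp, ← map_mul]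
      congr 1
      have e3 : (1 + (c - d) * u)⁻¹ = -(c - d)⁻¹ * (-(c - d)⁻¹ - u)⁻¹ := by
        rw [← inv_neg, ← mul_inv]
        congr 1
        field_simp
        ring
      rw [e3]
      field_simp
      ring
    rw [Finset.sum_congr rfl fun u _ => e u, ← Finset.mul_sum, norm_mul]
    have hw := weil_bound hp hχ (r₁ := -(a - d)⁻¹) (r₂ := -(b - d)⁻¹) (r₃ := -(c - d)⁻¹)
      (by simpa using hac.symm) (by simpa using hbc.symm)
    exact (mul_le_mul (norm_char_le_one _ _) hw (norm_nonneg _) zero_le_one).trans_eq (one_mul _)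
  · intro u hu
    have e : ∀ y : ZMod p, u⁻¹ - d + y = u⁻¹ * (1 + (y - d) * u) := by
      intro y; field_simp; ring
    rw [e, e, e, sub_add_cancel]
    congr 1
    rw [mul_inv, inv_inv]
    field_simp

theorem norm_sum_char_four_le (hp : 3 ≤ p) {χ : MulChar (ZMod p) ℂ} (hχ : χ ≠ 1)
    (a b c d : ZMod p) :
    ‖∑ x, χ ((x + a) * (x + b) * (x + c)⁻¹ * (x + d)⁻¹)‖ ≤ 2 * √p + 1 +
      p * ((if a = c then if b = d then 1 else 0 else 0) +
        (if a = d then if b = c then 1 else 0 else 0) +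
        (if a = b then if c = d then 1 else 0 else 0)) := by
  have htriv : ‖∑ x, χ ((x + a) * (x + b) * (x + c)⁻¹ * (x + d)⁻¹)‖ ≤ p := by
    refine (norm_sum_le _ _).trans ((Finset.sum_le_sum fun x _ => norm_char_le_one _ _).trans ?_)
    simp
  have hp0 : (0 : ℝ) ≤ p := Nat.cast_nonneg p
  have hs : 1 ≤ √(p : ℝ) := Real.one_le_sqrt.2 (by exact_mod_cast (by omega : 1 ≤ p))
  have hpos : (0 : ℝ) ≤ p * ((if a = c then if b = d then 1 else 0 else 0) +
        (if a = d then if b = c then 1 else 0 else 0) +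
        (if a = b then if c = d then 1 else 0 else 0)) := by
    refine mul_nonneg hp0 (add_nonneg (add_nonneg ?_ ?_) ?_) <;> split_ifs <;> norm_num
  have hbig : 1 ≤ ((if a = c then if b = d then (1 : ℝ) else 0 else 0) +
        (if a = d then if b = c then 1 else 0 else 0) +
        (if a = b then if c = d then 1 else 0 else 0)) → ‖∑ x, χ ((x + a) * (x + b) *
        (x + c)⁻¹ * (x + d)⁻¹)‖ ≤ 2 * √p + 1 +
      p * ((if a = c then if b = d then 1 else 0 else 0) +
        (if a = d then if b = c then 1 else 0 else 0) +
        (if a = b then if c = d then 1 else 0 else 0)) := by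
    intro h
    have := mul_le_mul_of_nonneg_left h hp0
    linarith
  have hnn : ∀ (P Q : Prop) [Decidable P] [Decidable Q],
      (0 : ℝ) ≤ if P then if Q then 1 else 0 else 0 := by
    intro P Q _ _; split_ifs <;> norm_num
  have two : ∀ {y : ℝ}, y ≤ 2 → y ≤ 2 * √p + 1 := fun h => by linarith
  by_cases h1 : a = c ∧ b = d
  · refine hbig ?_
    rw [if_pos h1.1, if_pos h1.2]
    linarith [hnn (a = d) (b = c), hnn (a = b) (c = d)]
  by_cases h2 : a = d ∧ b = c
  · refine hbig ?_
    rw [if_pos h2.1, if_pos h2.2]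
    linarith [hnn (a = c) (b = d), hnn (a = b) (c = d)]
  by_cases h3 : a = b ∧ c = d
  · refine hbig ?_
    rw [if_pos h3.1, if_pos h3.2]
    linarith [hnn (a = c) (b = d), hnn (a = d) (b = c)]
  refine le_add_of_le_of_nonneg ?_ hpos
  by_cases hac : a = c
  · subst hac
    exact two (norm_sum_char_four_le_of_eq hχ fun h => h1 ⟨rfl, h⟩)
  by_cases had : a = d
  · subst had
    refine two ((le_of_eq ?_).trans (norm_sum_char_four_le_of_eq hχ (a := a) (b := b) (d := c)
      fun h => h2 ⟨rfl, h⟩))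
    congr 2 with x; congr 1; ring
  by_cases hbc : b = c
  · subst hbc
    refine two ((le_of_eq ?_).trans (norm_sum_char_four_le_of_eq hχ (a := b) (b := a) (d := d)
      had))
    congr 2 with x; congr 1; ring
  by_cases hbd : b = d
  · subst hbd
    refine two ((le_of_eq ?_).trans (norm_sum_char_four_le_of_eq hχ (a := b) (b := a) (d := c)
      hac))
    congr 2 with x; congr 1; ring
  by_cases hcd : c = d
  · have hab : a ≠ b := fun h => h3 ⟨h, hcd⟩
    refine (le_of_eq ?_).trans (norm_sum_char_four_le_of_ne hp hχ (a := c) (b := d) (c := a)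
      (d := b) (Ne.symm hac) (Ne.symm hbc) (Ne.symm had) (Ne.symm hbd) hab)
    rw [← Complex.norm_conj, map_sum]
    congr 2 with x
    rw [conj_char]
    congr 1
    simp only [mul_inv, inv_inv]
    ring
  · exact norm_sum_char_four_le_of_ne hp hχ hac had hbc hbd hcd

/-- The fourth moment of short character sums. -/
theorem sum_norm_pow_four_le (hp : 3 ≤ p) {χ : MulChar (ZMod p) ℂ} (hχ : χ ≠ 1)
    (I : Finset (ZMod p)) :
    ∑ x, ‖∑ b ∈ I, χ (x + b)‖ ^ 4 ≤ (2 * √p + 1) * (I.card : ℝ) ^ 4 + 3 * p * (I.card : ℝ) ^ 2 := by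
  have e : ((∑ x, ‖∑ b ∈ I, χ (x + b)‖ ^ 4 : ℝ) : ℂ) = ∑ a ∈ I, ∑ b ∈ I, ∑ c ∈ I, ∑ d ∈ I,
      ∑ x, χ ((x + a) * (x + b) * (x + c)⁻¹ * (x + d)⁻¹) := by
    have e1 : ∀ x, ((‖∑ b ∈ I, χ (x + b)‖ ^ 4 : ℝ) : ℂ) = ∑ a ∈ I, ∑ b ∈ I, ∑ c ∈ I, ∑ d ∈ I,
        χ ((x + a) * (x + b) * (x + c)⁻¹ * (x + d)⁻¹) := by
      intro x
      set F := ∑ b ∈ I, χ (x + b) with hF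
      have h2 : ((‖F‖ ^ 4 : ℝ) : ℂ) = (starRingEnd ℂ) F * ((starRingEnd ℂ) F * (F * F)) := by
        have := Complex.mul_conj' F
        push_cast
        linear_combination (-(F * (starRingEnd ℂ) F) - (‖F‖ : ℂ) ^ 2) * this
      rw [h2, hF, map_sum]
      simp only [Finset.mul_sum, Finset.sum_mul, conj_char, map_mul]
      refine Finset.sum_congr rfl fun a _ => Finset.sum_congr rfl fun b _ =>
        Finset.sum_congr rfl fun c _ => Finset.sum_congr rfl fun d _ => ?_
      ring
    push_cast [← e1]
    simp_rw [← Complex.ofReal_pow, e1]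
    rw [Finset.sum_comm]
    refine Finset.sum_congr rfl fun a _ => ?_
    rw [Finset.sum_comm]
    refine Finset.sum_congr rfl fun b _ => ?_
    rw [Finset.sum_comm]
    refine Finset.sum_congr rfl fun c _ => ?_
    rw [Finset.sum_comm]
  have h : ∑ x, ‖∑ b ∈ I, χ (x + b)‖ ^ 4 ≤ ∑ a ∈ I, ∑ b ∈ I, ∑ c ∈ I, ∑ d ∈ I,
      ‖∑ x, χ ((x + a) * (x + b) * (x + c)⁻¹ * (x + d)⁻¹)‖ := by
    have h0 : 0 ≤ ∑ x, ‖∑ b ∈ I, χ (x + b)‖ ^ 4 := Finset.sum_nonneg fun x _ => by positivity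
    rw [← Complex.norm_of_nonneg h0, e]
    refine (norm_sum_le _ _).trans (Finset.sum_le_sum fun a _ => ?_)
    refine (norm_sum_le _ _).trans (Finset.sum_le_sum fun b _ => ?_)
    refine (norm_sum_le _ _).trans (Finset.sum_le_sum fun c _ => ?_)
    exact norm_sum_le _ _
  refine h.trans ((Finset.sum_le_sum fun a _ => Finset.sum_le_sum fun b _ =>
    Finset.sum_le_sum fun c _ => Finset.sum_le_sum fun d _ =>
      norm_sum_char_four_le hp hχ a b c d).trans (le_of_eq ?_))
  simp only [mul_add, Finset.sum_add_distrib, Finset.sum_const, nsmul_eq_mul,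
    mul_ite, mul_one, mul_zero]
  have s1 : ∑ a ∈ I, ∑ b ∈ I, ∑ c ∈ I, ∑ d ∈ I,
      (if a = c then if b = d then (p : ℝ) else 0 else 0) = p * (I.card : ℝ) ^ 2 := by
    rw [Finset.sum_congr rfl (g := fun _ => (I.card : ℝ) * p)]
    · simp; ring
    intro a ha
    rw [Finset.sum_congr rfl (g := fun _ => (p : ℝ))]
    · simp
    intro b hb
    rw [Finset.sum_comm]
    simp [ha, hb]
  have s2 : ∑ a ∈ I, ∑ b ∈ I, ∑ c ∈ I, ∑ d ∈ I,
      (if a = d then if b = c then (p : ℝ) else 0 else 0) = p * (I.card : ℝ) ^ 2 := by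
    rw [← s1]
    exact Finset.sum_congr rfl fun a _ => Finset.sum_congr rfl fun b _ => Finset.sum_comm
  have s3 : ∑ a ∈ I, ∑ b ∈ I, ∑ c ∈ I, ∑ d ∈ I,
      (if a = b then if c = d then (p : ℝ) else 0 else 0) = p * (I.card : ℝ) ^ 2 := by
    rw [← s1]
    exact Finset.sum_congr rfl fun a _ => Finset.sum_comm
  rw [s1, s2, s3]
  ring

end FourthMoment

section ShortSums

open Finset

theorem sum_comp_pow_four_le {X Y : Type*} [Fintype X] [DecidableEq X] (S : Finset Y) (π : Y → X)
    (F : X → ℝ) :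
    (∑ y ∈ S, F (π y)) ^ 4 ≤ (#S : ℝ) ^ 2 * #{z ∈ S ×ˢ S | π z.1 = π z.2} * ∑ x, F x ^ 4 := by
  have h1 : (∑ y ∈ S, F (π y)) ^ 2 ≤ #S * ∑ y ∈ S, F (π y) ^ 2 := sq_sum_le_card_mul_sum_sq
  have h2 : ∑ y ∈ S, F (π y) ^ 2 = ∑ x, (#{y ∈ S | π y = x} : ℝ) * F x ^ 2 := by
    rw [← sum_fiberwise S π]
    refine sum_congr rfl fun x _ => ?_
    rw [sum_congr rfl (g := fun _ => F x ^ 2) fun y hy => by rw [(mem_filter.1 hy).2]]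
    simp
  have h3 : (∑ x, (#{y ∈ S | π y = x} : ℝ) * F x ^ 2) ^ 2 ≤
      (∑ x, (#{y ∈ S | π y = x} : ℝ) ^ 2) * ∑ x, (F x ^ 2) ^ 2 := sum_mul_sq_le_sq_mul_sq _ _ _
  have h4 : (#{z ∈ S ×ˢ S | π z.1 = π z.2} : ℝ) = ∑ x, (#{y ∈ S | π y = x} : ℝ) ^ 2 := by
    rw [card_eq_sum_card_fiberwise (f := fun z => π z.1) (t := univ) (by simp)]
    push_cast
    refine sum_congr rfl fun x _ => ?_
    rw [sq, ← Nat.cast_mul, ← card_product]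
    congr 2
    ext z
    simp only [mem_filter, mem_product]
    constructor
    · rintro ⟨⟨⟨h, h'⟩, e⟩, e'⟩
      exact ⟨⟨h, e'⟩, h', e ▸ e'⟩
    · rintro ⟨⟨h, e⟩, h', e'⟩
      exact ⟨⟨⟨h, h'⟩, e.trans e'.symm⟩, e⟩
  have h5 : ∑ x, (F x ^ 2) ^ 2 = ∑ x, F x ^ 4 := sum_congr rfl fun x _ => by ring
  calc (∑ y ∈ S, F (π y)) ^ 4 = ((∑ y ∈ S, F (π y)) ^ 2) ^ 2 := by ring
    _ ≤ (#S * ∑ y ∈ S, F (π y) ^ 2) ^ 2 := by gcongr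
    _ = (#S : ℝ) ^ 2 * (∑ x, (#{y ∈ S | π y = x} : ℝ) * F x ^ 2) ^ 2 := by rw [h2]; ring
    _ ≤ (#S : ℝ) ^ 2 * ((∑ x, (#{y ∈ S | π y = x} : ℝ) ^ 2) * ∑ x, (F x ^ 2) ^ 2) := by gcongr
    _ = _ := by rw [h4, h5]; ring

theorem sum_inv_max_sq_le (A : ℕ) :
    ∑ k ∈ Icc 1 A, ∑ l ∈ Icc 1 A, (1 : ℝ) / (max k l : ℕ) ^ 2 ≤ 2 * (1 + Real.log A) := by
  have key : ∀ k ∈ Icc 1 A, ∑ l ∈ Icc 1 A, (if l ≤ k then (1 : ℝ) / (k : ℝ) ^ 2 else 0) =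
      (k : ℝ)⁻¹ := by
    intro k hk
    rw [mem_Icc] at hk
    rw [← sum_filter, sum_const,
      show {l ∈ Icc 1 A | l ≤ k} = Icc 1 k by ext l; simp; omega]
    have : (k : ℝ) ≠ 0 := by exact_mod_cast (by omega : k ≠ 0)
    simp
    field_simp
  have hH : ∑ k ∈ Icc 1 A, (k : ℝ)⁻¹ ≤ 1 + Real.log A := by
    have := harmonic_le_one_add_log A
    rw [harmonic_eq_sum_Icc] at this
    push_cast at this
    exact this
  have hle : ∀ k l : ℕ, (1 : ℝ) / (max k l : ℕ) ^ 2 ≤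
      (if l ≤ k then (1 : ℝ) / (k : ℝ) ^ 2 else 0) +
      (if k ≤ l then (1 : ℝ) / (l : ℝ) ^ 2 else 0) := by
    intro k l
    rcases le_total l k with h | h
    · rw [max_eq_left h, if_pos h]
      refine le_add_of_nonneg_right ?_
      split_ifs <;> positivity
    · rw [max_eq_right h, if_pos h]
      refine le_add_of_nonneg_left ?_
      split_ifs <;> positivity
  calc _ ≤ ∑ k ∈ Icc 1 A, ∑ l ∈ Icc 1 A, ((if l ≤ k then (1 : ℝ) / (k : ℝ) ^ 2 else 0) +
      (if k ≤ l then (1 : ℝ) / (l : ℝ) ^ 2 else 0)) :=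
        sum_le_sum fun k _ => sum_le_sum fun l _ => hle k l
    _ = ∑ k ∈ Icc 1 A, (k : ℝ)⁻¹ + ∑ k ∈ Icc 1 A, (k : ℝ)⁻¹ := by
        simp only [sum_add_distrib]
        congr 1
        · exact sum_congr rfl key
        · rw [sum_comm]
          exact sum_congr rfl key
    _ ≤ _ := by linarith

/-- The number of solutions of `m a' = m' a` in a box. -/
theorem card_equal_ratios_le (M A : ℕ) :
    (#{z ∈ (Icc 1 M ×ˢ Icc 1 A) ×ˢ (Icc 1 M ×ˢ Icc 1 A) | z.1.1 * z.2.2 = z.2.1 * z.1.2} : ℝ) ≤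
      2 * M * A * (1 + Real.log A) := by
  have hsub : {z ∈ (Icc 1 M ×ˢ Icc 1 A) ×ˢ (Icc 1 M ×ˢ Icc 1 A) | z.1.1 * z.2.2 = z.2.1 * z.1.2} ⊆
      (Icc 1 A).biUnion fun k => (Icc 1 A).biUnion fun l =>
        (Icc 1 (M / max k l) ×ˢ Icc 1 (A / max k l)).image
          fun w => ((k * w.1, k * w.2), (l * w.1, l * w.2)) := by
    rintro ⟨⟨m, a⟩, ⟨m', a'⟩⟩ hz
    simp only [mem_filter, mem_product, mem_Icc] at hz
    obtain ⟨⟨⟨⟨hm, hmM⟩, ha, haA⟩, ⟨hm', hmM'⟩, ha', haA'⟩, h⟩ := hz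
    obtain ⟨k, u, v, hk, hc, rfl, rfl⟩ := Nat.exists_coprime' (Nat.gcd_pos_of_pos_left a hm)
    have h1 : u * a' = m' * v := by
      refine Nat.eq_of_mul_eq_mul_right hk ?_
      linarith
    obtain ⟨l, rfl⟩ : v ∣ a' := hc.symm.dvd_of_dvd_mul_left (h1 ▸ Dvd.intro_left _ rfl)
    have hv : 0 < v := Nat.pos_of_mul_pos_right ha
    have hu : 0 < u := Nat.pos_of_mul_pos_right hm
    have hl : 0 < l := Nat.pos_of_mul_pos_left ha'
    obtain rfl : m' = u * l := by
      refine Nat.eq_of_mul_eq_mul_right hv ?_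
      linarith
    have hmax : 0 < max k l := by omega
    simp only [mem_biUnion, mem_image, mem_product, mem_Icc, Prod.mk.injEq]
    refine ⟨k, ⟨hk, ?_⟩, l, ⟨hl, ?_⟩, (u, v), ⟨⟨hu, ?_⟩, hv, ?_⟩, ⟨mul_comm _ _, mul_comm _ _⟩,
      mul_comm _ _, mul_comm _ _⟩
    · nlinarith
    · nlinarith
    · rw [Nat.le_div_iff_mul_le hmax]
      rcases le_total k l with h | h
      · rwa [max_eq_right h]
      · rwa [max_eq_left h]
    · rw [Nat.le_div_iff_mul_le hmax]
      rcases le_total k l with h | h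
      · rwa [max_eq_right h]
      · rwa [max_eq_left h]
  have hcard : #{z ∈ (Icc 1 M ×ˢ Icc 1 A) ×ˢ (Icc 1 M ×ˢ Icc 1 A) |
      z.1.1 * z.2.2 = z.2.1 * z.1.2} ≤
      ∑ k ∈ Icc 1 A, ∑ l ∈ Icc 1 A, (M / max k l) * (A / max k l) := by
    refine (card_le_card hsub).trans (card_biUnion_le.trans (sum_le_sum fun k _ =>
      card_biUnion_le.trans (sum_le_sum fun l _ => card_image_le.trans ?_)))
    simp
  calc _ ≤ ((∑ k ∈ Icc 1 A, ∑ l ∈ Icc 1 A, (M / max k l) * (A / max k l) : ℕ) : ℝ) := by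
        exact_mod_cast hcard
    _ ≤ ∑ k ∈ Icc 1 A, ∑ l ∈ Icc 1 A, (M * A : ℝ) * (1 / (max k l : ℕ) ^ 2) := by
        push_cast
        refine sum_le_sum fun k _ => sum_le_sum fun l _ => ?_
        have h1 : ((M / max k l : ℕ) : ℝ) ≤ M / (max k l : ℕ) := Nat.cast_div_le
        have h2 : ((A / max k l : ℕ) : ℝ) ≤ A / (max k l : ℕ) := Nat.cast_div_le
        refine (mul_le_mul h1 h2 (by positivity) (by positivity)).trans_eq ?_
        push_cast
        ring
    _ ≤ (M * A : ℝ) * (2 * (1 + Real.log A)) := by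
        simp only [← mul_sum]
        exact mul_le_mul_of_nonneg_left (sum_inv_max_sq_le A) (by positivity)
    _ = _ := by ring

variable {p : ℕ} [Fact p.Prime]

/-- A character sum over the values `m + a b` of a box. -/
theorem norm_sum_char_box_pow_four_le (hp : 3 ≤ p) {χ : MulChar (ZMod p) ℂ} (hχ : χ ≠ 1)
    {M A B : ℕ} (hMA : M * A < p) (hA : A < p) (hB : B < p) :
    ‖∑ z ∈ Icc 1 M ×ˢ Icc 1 A, ∑ b ∈ Icc 1 B, χ ((z.1 + z.2 * b : ℕ) : ZMod p)‖ ^ 4 ≤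
      (M * A : ℝ) ^ 2 * (2 * M * A * (1 + Real.log A)) *
        ((2 * √p + 1) * (B : ℝ) ^ 4 + 3 * p * (B : ℝ) ^ 2) := by
  have hcast : ∀ {n : ℕ}, 0 < n → n < p → (n : ZMod p) ≠ 0 := by
    intro n hn hnp h
    rw [ZMod.natCast_eq_zero_iff] at h
    exact absurd (Nat.le_of_dvd hn h) (by omega)
  have hinj : Set.InjOn (fun b : ℕ => (b : ZMod p)) (Icc 1 B : Finset ℕ) := by
    intro b hb b' hb' h
    simp only [coe_Icc, Set.mem_Icc] at hb hb'
    have := (ZMod.natCast_eq_natCast_iff' _ _ _).1 h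
    rwa [Nat.mod_eq_of_lt (by omega), Nat.mod_eq_of_lt (by omega)] at this
  set I : Finset (ZMod p) := (Icc 1 B).image (fun b : ℕ => (b : ZMod p)) with hI
  have hIc : #I = B := by rw [hI, card_image_of_injOn hinj]; simp
  set S := Icc 1 M ×ˢ Icc 1 A with hS
  have h1 : ‖∑ z ∈ S, ∑ b ∈ Icc 1 B, χ ((z.1 + z.2 * b : ℕ) : ZMod p)‖ ≤
      ∑ z ∈ S, ‖∑ b ∈ I, χ ((z.1 : ZMod p) * (z.2 : ZMod p)⁻¹ + b)‖ := by
    refine (norm_sum_le _ _).trans (sum_le_sum fun z hz => ?_)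
    rw [hS, mem_product, mem_Icc, mem_Icc] at hz
    have hz0 : (z.2 : ZMod p) ≠ 0 := hcast hz.2.1 (by omega)
    rw [hI, sum_image hinj]
    have : ∀ b : ℕ, χ ((z.1 + z.2 * b : ℕ) : ZMod p) =
        χ (z.2 : ZMod p) * χ ((z.1 : ZMod p) * (z.2 : ZMod p)⁻¹ + b) := by
      intro b
      rw [← map_mul]
      congr 1
      push_cast
      field_simp
    simp only [this]
    rw [← mul_sum, norm_mul]
    exact mul_le_of_le_one_left (norm_nonneg _) (norm_char_le_one χ _)
  have h2 := sum_comp_pow_four_le S (fun z => (z.1 : ZMod p) * (z.2 : ZMod p)⁻¹)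
    (fun x => ‖∑ b ∈ I, χ (x + b)‖)
  have h3 := sum_norm_pow_four_le hp hχ I
  have h4 : (#{z ∈ S ×ˢ S | (z.1.1 : ZMod p) * (z.1.2 : ZMod p)⁻¹ =
      (z.2.1 : ZMod p) * (z.2.2 : ZMod p)⁻¹} : ℝ) ≤ 2 * M * A * (1 + Real.log A) := by
    refine le_trans ?_ (card_equal_ratios_le M A)
    refine Nat.cast_le.2 (card_le_card fun z hz => ?_)
    rw [mem_filter] at hz ⊢
    refine ⟨hz.1, ?_⟩
    obtain ⟨hz, h⟩ := hz
    simp only [hS, mem_product, mem_Icc] at hz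
    have e1 : (z.1.2 : ZMod p) ≠ 0 := hcast hz.1.2.1 (by omega)
    have e2 : (z.2.2 : ZMod p) ≠ 0 := hcast hz.2.2.1 (by omega)
    have h' : ((z.1.1 * z.2.2 : ℕ) : ZMod p) = ((z.2.1 * z.1.2 : ℕ) : ZMod p) := by
      push_cast
      field_simp at h
      linear_combination h
    have l1 := Nat.mul_le_mul hz.1.1.2 hz.2.2.2
    have l2 := Nat.mul_le_mul hz.2.1.2 hz.1.2.2
    have := (ZMod.natCast_eq_natCast_iff' _ _ _).1 h'
    rwa [Nat.mod_eq_of_lt (by omega), Nat.mod_eq_of_lt (by omega)] at this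
  have hlog : 0 ≤ Real.log A := Real.log_natCast_nonneg A
  calc _ ≤ (∑ z ∈ S, ‖∑ b ∈ I, χ ((z.1 : ZMod p) * (z.2 : ZMod p)⁻¹ + b)‖) ^ 4 :=
        pow_le_pow_left₀ (norm_nonneg _) h1 4
    _ ≤ _ := h2
    _ ≤ (M * A : ℝ) ^ 2 * (2 * M * A * (1 + Real.log A)) *
        ((2 * √p + 1) * (B : ℝ) ^ 4 + 3 * p * (B : ℝ) ^ 2) := by
      have hc : (#S : ℝ) = M * A := by rw [hS]; simp
      rw [hc]
      rw [hIc] at h3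
      refine mul_le_mul (mul_le_mul_of_nonneg_left h4 (by positivity)) h3
        (sum_nonneg fun x _ => by positivity) (by positivity)

end ShortSums

section Sieve

open Finset

variable {p : ℕ} [Fact p.Prime]

/-- The indicator of the `q`-free residue classes, those that are not `q`-th powers when
`q` is a prime divisor of `p - 1`. -/
noncomputable def freeIndicator (q : ℕ) (x : ZMod p) : ℝ := if x ^ ((p - 1) / q) = 1 then 0 else 1

theorem freeIndicator_nonneg (q : ℕ) (x : ZMod p) : 0 ≤ freeIndicator q x := by
  unfold freeIndicator; split_ifs <;> norm_num

theorem exists_char_freeIndicator {q : ℕ} (hq : q.Prime) (hqp : q ∣ p - 1) :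
    ∃ χ : MulChar (ZMod p) ℂ, orderOf χ = q ∧ ∀ x : ZMod p, x ≠ 0 →
      (freeIndicator q x : ℂ) = (1 - 1 / q) - 1 / q * ∑ j ∈ Icc 1 (q - 1), (χ ^ j) x := by
  have hp1 : 0 < p - 1 := Nat.sub_pos_of_lt (Fact.out : p.Prime).one_lt
  obtain ⟨χ, hχ⟩ := MulChar.exists_mulChar_orderOf (ZMod p) (n := q) (R := ℂ)
    (by rwa [ZMod.card]) (Complex.isPrimitiveRoot_exp q hq.ne_zero)
  refine ⟨χ, hχ, fun x hx => ?_⟩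
  obtain ⟨g, hg⟩ := IsCyclic.exists_generator (α := (ZMod p)ˣ)
  have hog : orderOf g = p - 1 := by
    rw [orderOf_eq_card_of_forall_mem_zpowers hg, Nat.card_eq_fintype_card, ZMod.card_units]
  have hχ1 : χ ≠ 1 := by
    rintro rfl
    rw [orderOf_one] at hχ
    exact hq.ne_one hχ.symm
  have hζ : orderOf (χ g) = q := by
    have := Fact.mk hq
    refine orderOf_eq_prime ?_ fun h => hχ1 ?_
    · rw [← MulChar.pow_apply_coe, ← hχ, pow_orderOf_eq_one, MulChar.one_apply_coe]
    · ext a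
      obtain ⟨t, rfl⟩ := (mem_powers_iff_mem_zpowers (x := g)).2 (hg a)
      simp [h, MulChar.one_apply_coe]
  obtain ⟨t, ht⟩ := (mem_powers_iff_mem_zpowers (x := g)).2 (hg (Units.mk0 x hx))
  have hxt : x = (g : ZMod p) ^ t := by
    have := congrArg Units.val ht
    simpa using this.symm
  obtain ⟨r, hr⟩ := hqp
  have hr0 : 0 < r := Nat.pos_of_mul_pos_left (hr ▸ hp1)
  have hdiv : (p - 1) / q = r := by rw [hr, Nat.mul_div_cancel_left _ hq.pos]
  have hiff : x ^ ((p - 1) / q) = 1 ↔ χ x = 1 := by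
    rw [hdiv, hxt, map_pow, ← orderOf_dvd_iff_pow_eq_one (x := χ g), hζ, ← pow_mul,
      ← Units.val_pow_eq_pow_val, Units.val_eq_one, ← orderOf_dvd_iff_pow_eq_one, hog, hr,
      Nat.mul_dvd_mul_iff_right hr0]
  have hpow : (χ x) ^ q = 1 := by
    rw [hxt, map_pow, ← pow_mul, mul_comm, pow_mul, ← hζ, pow_orderOf_eq_one, one_pow]
  have hsum : ∑ j ∈ Icc 1 (q - 1), (χ ^ j) x = ∑ j ∈ range q, (χ x) ^ j - 1 := by
    rw [range_eq_Ico, sum_eq_sum_Ico_succ_bot hq.pos, pow_zero, add_sub_cancel_left]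
    refine sum_congr ?_ fun j hj => ?_
    · ext j; simp; have := hq.pos; omega
    · rw [MulChar.pow_apply' _ (by simp at hj; omega)]
  have hq0 : (q : ℂ) ≠ 0 := by exact_mod_cast hq.ne_zero
  rw [hsum, freeIndicator]
  by_cases h : χ x = 1
  · rw [if_pos (hiff.2 h), h]
    simp
    field_simp
    ring
  · rw [if_neg (hiff.not.2 h), geom_sum_eq h, hpow]
    simp

/-- The sum of `ψ` over the values `n y` that are `q`-free for every `q ∈ S`. -/
noncomputable def sieveSum {Y : Type*} (T : Finset Y) (n : Y → ZMod p) (S : Finset ℕ)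
    (ψ : MulChar (ZMod p) ℂ) : ℂ :=
  ∑ y ∈ T, ψ (n y) * ∏ q ∈ S, (freeIndicator q (n y) : ℂ)

variable {Y : Type*} {T : Finset Y} {n : Y → ZMod p}

theorem sieveSum_insert (hn : ∀ y ∈ T, n y ≠ 0) {q : ℕ} {χ : MulChar (ZMod p) ℂ}
    (h : ∀ x : ZMod p, x ≠ 0 →
      (freeIndicator q x : ℂ) = (1 - 1 / q) - 1 / q * ∑ j ∈ Icc 1 (q - 1), (χ ^ j) x)
    {S : Finset ℕ} (hqS : q ∉ S) (ψ : MulChar (ZMod p) ℂ) :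
    sieveSum T n (insert q S) ψ = (1 - 1 / q) * sieveSum T n S ψ -
      1 / q * ∑ j ∈ Icc 1 (q - 1), sieveSum T n S (ψ * χ ^ j) := by
  simp only [sieveSum]
  rw [sum_comm, mul_sum, mul_sum, ← sum_sub_distrib]
  refine sum_congr rfl fun y hy => ?_
  rw [prod_insert hqS, h _ (hn y hy)]
  simp only [MulChar.mul_apply, ← sum_mul, ← mul_sum]
  ring

/-- The proportion of residue classes that are `q`-free for all `q ∈ S`. -/
noncomputable def freeDensity (S : Finset ℕ) : ℝ := ∏ q ∈ S, (1 - 1 / (q : ℝ))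

theorem freeDensity_pos {S : Finset ℕ} (hS : ∀ q ∈ S, q.Prime) : 0 < freeDensity S := by
  refine prod_pos fun q hq => ?_
  have : (1 : ℝ) < q := by exact_mod_cast (hS q hq).one_lt
  rw [sub_pos, div_lt_one (by linarith)]
  exact this

theorem freeDensity_insert {q : ℕ} {S : Finset ℕ} (hqS : q ∉ S) :
    freeDensity (insert q S) = (1 - 1 / (q : ℝ)) * freeDensity S :=
  prod_insert hqS

theorem norm_one_sub_inv {q : ℕ} (hq : q.Prime) : ‖(1 - 1 / q : ℂ)‖ = 1 - 1 / (q : ℝ) := by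
  have : (1 : ℝ) < q := by exact_mod_cast hq.one_lt
  have h : (0 : ℝ) ≤ 1 - 1 / (q : ℝ) := by
    rw [sub_nonneg, div_le_one (by linarith)]
    exact this.le
  rw [← Complex.norm_of_nonneg h]
  push_cast
  rfl

theorem norm_inv_mul_sum_le {q : ℕ} (hq : q.Prime) {f : ℕ → ℂ} {K : ℝ}
    (h : ∀ j ∈ Icc 1 (q - 1), ‖f j‖ ≤ K) :
    ‖1 / (q : ℂ) * ∑ j ∈ Icc 1 (q - 1), f j‖ ≤ (1 - 1 / (q : ℝ)) * K := by
  have hq0 : (0 : ℝ) < q := by exact_mod_cast hq.pos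
  rw [norm_mul, norm_div, norm_one, Complex.norm_natCast]
  have := (norm_sum_le _ _).trans (sum_le_card_nsmul _ _ _ h)
  rw [Nat.card_Icc, Nat.add_sub_cancel, nsmul_eq_mul, Nat.cast_sub hq.one_le] at this
  refine (mul_le_mul_of_nonneg_left this (by positivity)).trans_eq ?_
  field_simp
  rw [Nat.cast_one, mul_comm]

variable {E : ℝ} (hE : ∀ χ : MulChar (ZMod p) ℂ, χ ≠ 1 → ‖∑ y ∈ T, χ (n y)‖ ≤ E)

include hE

theorem norm_sieveSum_le (hn : ∀ y ∈ T, n y ≠ 0) {S : Finset ℕ}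
    (hS : ∀ q ∈ S, q.Prime ∧ q ∣ p - 1) {ψ : MulChar (ZMod p) ℂ} (hψ : ψ ≠ 1) {k : ℕ}
    (hk : ψ ^ k = 1) (hkS : ∀ q ∈ S, q.Coprime k) :
    ‖sieveSum T n S ψ‖ ≤ freeDensity S * 2 ^ #S * E := by
  induction S using Finset.induction_on generalizing ψ k with
  | empty => simpa [sieveSum, freeDensity] using hE ψ hψ
  | insert q S hqS ih =>
    have hS' : ∀ r ∈ S, r.Prime ∧ r ∣ p - 1 := fun r hr => hS r (mem_insert_of_mem hr)
    obtain ⟨hq, hqp⟩ := hS q (mem_insert_self _ _)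
    have hqk := hkS q (mem_insert_self _ _)
    obtain ⟨χ, hχ, h⟩ := exists_char_freeIndicator hq hqp
    have hχq : χ ^ q = 1 := hχ ▸ pow_orderOf_eq_one χ
    rw [sieveSum_insert hn h hqS]
    have h1 := ih hS' hψ hk fun r hr => hkS r (mem_insert_of_mem hr)
    have h2 : ∀ j ∈ Icc 1 (q - 1), ‖sieveSum T n S (ψ * χ ^ j)‖ ≤
        freeDensity S * 2 ^ #S * E := by
      intro j _
      refine ih hS' (k := k * q) ?_ ?_ fun r hr => ?_
      · intro h0
        have e : ψ ^ q = 1 := by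
          have := congrArg (· ^ q) h0
          simpa only [mul_pow, ← pow_mul, mul_comm j q, pow_mul χ q j, hχq, one_pow, mul_one]
            using this
        refine hψ (orderOf_eq_one_iff.1 (Nat.dvd_one.1 ?_))
        rw [← hqk]
        exact Nat.dvd_gcd (orderOf_dvd_of_pow_eq_one e) (orderOf_dvd_of_pow_eq_one hk)
      · rw [mul_pow, pow_mul, hk, one_pow, one_mul, ← pow_mul,
          show j * (k * q) = q * (j * k) by ring, pow_mul, hχq, one_pow]
      · refine Nat.Coprime.mul_right (hkS r (mem_insert_of_mem hr)) ?_
        exact (Nat.coprime_primes (hS' r hr).1 hq).2 fun h => hqS (h ▸ hr)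
    have h3 := norm_inv_mul_sum_le hq h2
    have h4 : ‖(1 - 1 / q : ℂ) * sieveSum T n S ψ‖ ≤
        (1 - 1 / (q : ℝ)) * (freeDensity S * 2 ^ #S * E) := by
      rw [norm_mul, norm_one_sub_inv hq]
      refine mul_le_mul_of_nonneg_left h1 ?_
      rw [← norm_one_sub_inv hq]
      exact norm_nonneg _
    refine (norm_sub_le _ _).trans ((add_le_add h4 h3).trans_eq ?_)
    rw [freeDensity_insert hqS, card_insert_of_notMem hqS]
    ring

theorem norm_sieveSum_insert_sub_le (hn : ∀ y ∈ T, n y ≠ 0) {S : Finset ℕ}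
    (hS : ∀ q ∈ S, q.Prime ∧ q ∣ p - 1) {q : ℕ} (hq : q.Prime) (hqp : q ∣ p - 1) (hqS : q ∉ S) :
    ‖sieveSum T n (insert q S) 1 - (1 - 1 / q) * sieveSum T n S 1‖ ≤
      (1 - 1 / (q : ℝ)) * (freeDensity S * 2 ^ #S * E) := by
  obtain ⟨χ, hχ, h⟩ := exists_char_freeIndicator hq hqp
  rw [sieveSum_insert hn h hqS, sub_sub_cancel_left, norm_neg]
  refine norm_inv_mul_sum_le hq fun j hj => ?_
  rw [one_mul]
  refine norm_sieveSum_le hE hn hS (k := q) ?_ ?_ fun r hr => ?_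
  · rw [mem_Icc] at hj
    refine pow_ne_one_of_lt_orderOf (by omega) ?_
    rw [hχ]
    have := hq.pos
    omega
  · rw [← pow_mul, mul_comm, pow_mul, ← hχ, pow_orderOf_eq_one, one_pow]
  · exact (Nat.coprime_primes (hS r hr).1 hq).2 fun h => hqS (h ▸ hr)

theorem norm_sieveSum_one_sub_le (hn : ∀ y ∈ T, n y ≠ 0) {S : Finset ℕ}
    (hS : ∀ q ∈ S, q.Prime ∧ q ∣ p - 1) :
    ‖sieveSum T n S 1 - freeDensity S * #T‖ ≤ freeDensity S * (2 ^ #S - 1) * E := by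
  induction S using Finset.induction_on with
  | empty =>
    have : ∑ y ∈ T, (1 : MulChar (ZMod p) ℂ) (n y) = #T := by
      rw [sum_congr rfl fun y hy => MulChar.one_apply (hn y hy).isUnit]
      simp
    simp [sieveSum, freeDensity, this]
  | insert q S hqS ih =>
    have hS' : ∀ r ∈ S, r.Prime ∧ r ∣ p - 1 := fun r hr => hS r (mem_insert_of_mem hr)
    obtain ⟨hq, hqp⟩ := hS q (mem_insert_self _ _)
    have h1 := norm_sieveSum_insert_sub_le hE hn hS' hq hqp hqS
    have h2 : ‖(1 - 1 / q : ℂ) * (sieveSum T n S 1 - freeDensity S * #T)‖ ≤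
        (1 - 1 / (q : ℝ)) * (freeDensity S * (2 ^ #S - 1) * E) := by
      rw [norm_mul, norm_one_sub_inv hq]
      refine mul_le_mul_of_nonneg_left (ih hS') ?_
      rw [← norm_one_sub_inv hq]
      exact norm_nonneg _
    have e := freeDensity_insert hqS
    have e' : sieveSum T n (insert q S) 1 - freeDensity (insert q S) * #T =
        (sieveSum T n (insert q S) 1 - (1 - 1 / q) * sieveSum T n S 1) +
        (1 - 1 / q : ℂ) * (sieveSum T n S 1 - freeDensity S * #T) := by
      rw [e]
      push_cast
      ring
    rw [e', e, card_insert_of_notMem hqS]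
    refine (norm_add_le _ _).trans ((add_le_add h1 h2).trans_eq ?_)
    ring

/-- If the character sums over the values `n y` are small, then one of these values is free for
all primes in `S` and all the sieving primes `P i`. -/
theorem exists_free_of_sieve (hn : ∀ y ∈ T, n y ≠ 0) {S : Finset ℕ}
    (hS : ∀ q ∈ S, q.Prime ∧ q ∣ p - 1) {s : ℕ} {P : Fin s → ℕ}
    (hP : ∀ i, (P i).Prime ∧ P i ∣ p - 1) (hPS : ∀ i, P i ∉ S) {δ : ℝ}
    (hδ : δ = 1 - ∑ i, (1 : ℝ) / P i) (hδpos : 0 < δ) (hE0 : 0 ≤ E)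
    (hcard : E * 2 ^ #S * (((s : ℝ) - 1) / δ + 2) < #T) :
    ∃ y ∈ T, (∀ q ∈ S, n y ^ ((p - 1) / q) ≠ 1) ∧ ∀ i, n y ^ ((p - 1) / P i) ≠ 1 := by
  set N : Finset ℕ → ℝ := fun R => ∑ y ∈ T, ∏ q ∈ R, freeIndicator q (n y) with hN
  have hsieve : ∀ R : Finset ℕ, sieveSum T n R 1 = N R := by
    intro R
    rw [hN, sieveSum]
    push_cast
    refine sum_congr rfl fun y hy => ?_
    rw [MulChar.one_apply (hn y hy).isUnit, one_mul]
  have hθ := freeDensity_pos fun q hq => (hS q hq).1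
  set θ := freeDensity S
  have h1 : θ * (#T - (2 ^ #S - 1) * E) ≤ N S := by
    have := norm_sieveSum_one_sub_le hE hn hS
    rw [hsieve, ← Complex.ofReal_natCast, ← Complex.ofReal_mul, ← Complex.ofReal_sub,
      Complex.norm_real, Real.norm_eq_abs] at this
    linarith [(abs_le.1 this).1]
  have h2 : ∀ i, (1 - 1 / (P i : ℝ)) * (N S - θ * 2 ^ #S * E) ≤ N (insert (P i) S) := by
    intro i
    have := norm_sieveSum_insert_sub_le hE hn hS (hP i).1 (hP i).2 (hPS i)
    have e : ((N (insert (P i) S) : ℝ) : ℂ) - (1 - 1 / (P i : ℂ)) * (N S : ℝ) =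
        ((N (insert (P i) S) - (1 - 1 / (P i : ℝ)) * N S : ℝ) : ℂ) := by push_cast; rfl
    rw [hsieve, hsieve, e, Complex.norm_real, Real.norm_eq_abs] at this
    linarith [(abs_le.1 this).1]
  have h3 : ∑ y ∈ T, (∏ q ∈ S, freeIndicator q (n y)) *
      (1 - ∑ i, (1 - freeIndicator (P i) (n y))) = N S * (1 - s) + ∑ i, N (insert (P i) S) := by
    simp only [hN, prod_insert (hPS _), sum_sub_distrib, mul_sub, mul_sum, mul_one, sum_const,
      card_univ, Fintype.card_fin, nsmul_eq_mul]
    rw [sum_comm, ← sum_mul]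
    simp only [mul_comm]
    abel
  have h4 : 0 < N S * (1 - s) + ∑ i, N (insert (P i) S) := by
    have e : ∑ i, (1 - 1 / (P i : ℝ)) = s - 1 + δ := by
      rw [sum_sub_distrib, hδ]; simp
    have h5 := sum_le_sum fun i (_ : i ∈ univ) => h2 i
    rw [← sum_mul, e] at h5
    have h6 : 0 < δ * (#T - E * 2 ^ #S * (((s : ℝ) - 1) / δ + 2)) :=
      mul_pos hδpos (sub_pos.2 hcard)
    have h7 : δ * (#T - E * 2 ^ #S * (((s : ℝ) - 1) / δ + 2)) =
        δ * #T - E * 2 ^ #S * (s - 1 + 2 * δ) := by field_simp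
    have h8 := mul_pos hθ h6
    rw [h7] at h8
    have h9 := mul_le_mul_of_nonneg_left h1 hδpos.le
    have h10 : 0 ≤ θ * δ * E := by positivity
    linarith
  rw [← h3] at h4
  obtain ⟨y, hy, hpos⟩ := exists_lt_of_sum_lt (sum_const_zero.trans_lt h4)
  have hprod : 0 ≤ ∏ q ∈ S, freeIndicator q (n y) := prod_nonneg fun q _ => freeIndicator_nonneg q _
  refine ⟨y, hy, fun q hq h => ?_, fun i h => ?_⟩
  · rw [prod_eq_zero hq (by rw [freeIndicator, if_pos h]), zero_mul] at hpos
    exact lt_irrefl _ hpos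
  · have hle : ∀ j, 0 ≤ 1 - freeIndicator (P j) (n y) := by
      intro j; unfold freeIndicator; split_ifs <;> norm_num
    have h5 := single_le_sum (fun j _ => hle j) (mem_univ i)
    rw [freeIndicator, if_pos h] at h5
    exact absurd hpos (mul_nonpos_of_nonneg_of_nonpos hprod (by linarith)).not_gt

end Sieve

/-- The box of side lengths `M`, `A`, `B` given below beats the explicit Burgess constant. -/
theorem box_bound_le {p B A M : ℕ} (hp : 10 ^ 20 ≤ p) (hB : B = Nat.sqrt (Nat.sqrt p))
    (hA : A = B / 2) (hM : M = B ^ 2 / 2 - 3) :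
    (M * A : ℝ) ^ 2 * (2 * M * A * (1 + Real.log A)) *
        ((2 * √p + 1) * (B : ℝ) ^ 4 + 3 * p * (B : ℝ) ^ 2) ≤
      (3.5751 * Real.log p ^ ((1 : ℝ) / 4) * (p : ℝ) ^ (-(1 : ℝ) / 16) * (M * A * B)) ^ 4 := by
  have hpR : (10 : ℝ) ^ 20 ≤ p := by exact_mod_cast hp
  have hp0 : (0 : ℝ) < p := by linarith [show (0 : ℝ) < 10 ^ 20 by norm_num]
  have hB5 : 10 ^ 5 ≤ B := by
    rw [hB, Nat.le_sqrt, Nat.le_sqrt]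
    exact le_trans (by norm_num) hp
  obtain ⟨r, hr0, hr⟩ : ∃ r : ℝ, 0 < r ∧ r ^ 4 = p :=
    ⟨√√p, by positivity, by
      rw [show √√(p : ℝ) ^ 4 = (√√(p : ℝ) ^ 2) ^ 2 by ring, Real.sq_sqrt (by positivity),
        Real.sq_sqrt hp0.le]⟩
  have hsq : √(p : ℝ) = r ^ 2 := by
    rw [← hr, show r ^ 4 = (r ^ 2) ^ 2 by ring, Real.sqrt_sq (by positivity)]
  have hB4 : B ^ 4 ≤ p := by
    have h1 := Nat.sqrt_le' (Nat.sqrt p)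
    have h2 := Nat.sqrt_le' p
    rw [← hB] at h1
    calc B ^ 4 = (B ^ 2) ^ 2 := by ring
      _ ≤ (Nat.sqrt p) ^ 2 := Nat.pow_le_pow_left h1 2
      _ ≤ p := h2
  have hBr : (B : ℝ) ≤ r := by
    refine le_of_pow_le_pow_left₀ (n := 4) (by norm_num) hr0.le ?_
    rw [hr]
    exact_mod_cast hB4
  have hrB : r < B + 1 := by
    refine lt_of_pow_lt_pow_left₀ 4 (by positivity) ?_
    rw [hr]
    have h1 : Nat.sqrt p < (B + 1) ^ 2 := by rw [hB]; exact Nat.lt_succ_sqrt' _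
    have h2 : p < (Nat.sqrt p + 1) ^ 2 := Nat.lt_succ_sqrt' p
    have h3 : p < (B + 1) ^ 4 := by
      calc p < (Nat.sqrt p + 1) ^ 2 := h2
        _ ≤ ((B + 1) ^ 2) ^ 2 := Nat.pow_le_pow_left h1 2
        _ = _ := by ring
    exact_mod_cast h3
  have hB5' : (10 : ℝ) ^ 5 ≤ B := by exact_mod_cast hB5
  have hr5 : (10 : ℝ) ^ 5 ≤ r := hB5'.trans hBr
  have hAr : 0.499 * r ≤ A := by
    have : B ≤ 2 * A + 1 := by omega
    have : (B : ℝ) ≤ 2 * A + 1 := by exact_mod_cast this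
    linarith
  have hMr : 0.499 * r ^ 2 ≤ M := by
    have : B ^ 2 ≤ 2 * M + 7 := by omega
    have : (B : ℝ) ^ 2 ≤ 2 * M + 7 := by exact_mod_cast this
    have h := pow_le_pow_left₀ (by positivity) (by linarith : 0.9999 * r ≤ B) 2
    have h' := pow_le_pow_left₀ (by norm_num) hr5 2
    linarith
  have hlog1 : 1 ≤ Real.log p := by
    rw [Real.le_log_iff_exp_le hp0]
    linarith [Real.exp_one_lt_d9]
  have hlogA : Real.log A ≤ Real.log p := by
    refine Real.log_le_log (by linarith) ?_
    have : A ≤ p := by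
      have := Nat.le_self_pow (n := 4) (by norm_num) B
      omega
    exact_mod_cast this
  have hpow : ((p : ℝ) ^ (-(1 : ℝ) / 16)) ^ 4 * r = 1 := by
    have e : r = (p : ℝ) ^ ((1 : ℝ) / 4) := by
      rw [← hr, ← Real.rpow_natCast, ← Real.rpow_mul hr0.le]
      norm_num
    rw [e, ← Real.rpow_natCast, ← Real.rpow_mul hp0.le, ← Real.rpow_add hp0]
    norm_num
  have hlogpow : (Real.log p ^ ((1 : ℝ) / 4)) ^ 4 = Real.log p := by
    rw [← Real.rpow_natCast, ← Real.rpow_mul (by linarith)]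
    norm_num
  set Q := ((p : ℝ) ^ (-(1 : ℝ) / 16)) ^ 4 with hQ
  set L := Real.log p
  have hQ0 : 0 ≤ Q := by positivity
  have hbracket : (2 * √p + 1) * (B : ℝ) ^ 4 + 3 * p * (B : ℝ) ^ 2 ≤ 5.1 * r ^ 2 * B ^ 4 := by
    have h1 : r ^ 2 ≤ 1.001 * (B : ℝ) ^ 2 := by
      have := pow_le_pow_left₀ hr0.le (by linarith : r ≤ 1.0001 * B) 2
      linarith [sq_nonneg (B : ℝ)]
    have h2 : 1 ≤ 0.001 * r ^ 2 := by
      have := pow_le_pow_left₀ (by norm_num) hr5 2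
      linarith
    have h3 := mul_le_mul_of_nonneg_left h1 (by positivity : 0 ≤ r ^ 2 * (B : ℝ) ^ 2)
    have h4 := mul_le_mul_of_nonneg_right h2 (by positivity : 0 ≤ (B : ℝ) ^ 4)
    have h5 : 0 ≤ r ^ 2 * (B : ℝ) ^ 4 := by positivity
    rw [hsq, ← hr]
    linarith
  have hMA : 0.249 * r ^ 3 ≤ M * A := by
    have := mul_le_mul hMr hAr (by positivity) (by positivity)
    linarith [pow_pos hr0 3]
  have hL : 1 + Real.log A ≤ 2 * L := by linarith
  have hlogA0 : 0 ≤ Real.log A := Real.log_natCast_nonneg A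
  calc (M * A : ℝ) ^ 2 * (2 * M * A * (1 + Real.log A)) *
        ((2 * √p + 1) * (B : ℝ) ^ 4 + 3 * p * (B : ℝ) ^ 2)
      ≤ (M * A : ℝ) ^ 2 * (2 * M * A * (2 * L)) * (5.1 * r ^ 2 * B ^ 4) := by gcongr
    _ = 20.4 * L * (M * A) ^ 3 * B ^ 4 * (r ^ 2 * (Q * r)) := by rw [hpow]; ring
    _ = L * (M * A) ^ 3 * B ^ 4 * Q * (20.4 * r ^ 3) := by ring
    _ ≤ L * (M * A) ^ 3 * B ^ 4 * Q * (3.5751 ^ 4 * (0.249 * r ^ 3)) := by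
      gcongr L * (M * A) ^ 3 * B ^ 4 * Q * ?_
      linarith [pow_pos hr0 3]
    _ ≤ L * (M * A) ^ 3 * B ^ 4 * Q * (3.5751 ^ 4 * (M * A)) := by gcongr
    _ = _ := by
      have e : ∀ a b c d : ℝ, (a * b * c * d) ^ 4 = a ^ 4 * b ^ 4 * c ^ 4 * d ^ 4 :=
        fun a b c d => by ring
      rw [e, hlogpow, ← hQ]
      ring

theorem sieved_burgess_criterion (p₀ : ℝ) (hp₀ : (10 : ℝ) ^ 20 ≤ p₀)
    (p : ℕ) (hp : p.Prime) (hpp₀ : (p : ℝ) > p₀)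
    (e : ℕ) (he : Even e) (hed : e ∣ p - 1)
    (s : ℕ) (P : Fin s → ℕ)
    (hPinj : Function.Injective P)
    (hPprime : ∀ i, (P i).Prime)
    (hPdvd : ∀ i, P i ∣ p - 1)
    (hPnotdvd : ∀ i, ¬ P i ∣ e)
    (hPall : ∀ q : ℕ, q.Prime → q ∣ p - 1 → ¬ q ∣ e → ∃ i, P i = q)
    (δ : ℝ) (hδ : δ = 1 - ∑ i, (1 : ℝ) / (P i)) (hδpos : 0 < δ)
    (hcrit : ((Nat.totient e : ℝ) / (e : ℝ)) * (1 - 2 / p₀ ^ ((1 : ℝ) / 2)) *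
        (p : ℝ) ^ ((1 : ℝ) / 2) *
        (1 - 3.5751 * (1 - 2 / p₀ ^ ((1 : ℝ) / 2)) ^ (-(1 : ℝ) / 2) *
          (Real.log p) ^ ((1 : ℝ) / 4) * (((s : ℝ) - 1) / δ + 2) *
          (2 : ℝ) ^ e.primeFactors.card * (p : ℝ) ^ (-(1 : ℝ) / 16)) > 0) :
    (leastPrimitiveRoot p : ℝ) < Real.sqrt p - 2 := by
  have hfact := Fact.mk hp
  have hp20 : 10 ^ 20 ≤ p := by
    have : (10 : ℝ) ^ 20 ≤ p := hp₀.trans hpp₀.le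
    exact_mod_cast this
  have hp0 : (0 : ℝ) < p := by exact_mod_cast hp.pos
  have hlog : 0 ≤ Real.log p := Real.log_natCast_nonneg p
  have he0 : e ≠ 0 := by
    rintro rfl
    have := Nat.eq_zero_of_zero_dvd hed
    omega
  set c : ℝ := 3.5751 * Real.log p ^ ((1 : ℝ) / 4) * (p : ℝ) ^ (-(1 : ℝ) / 16) with hc
  have hc0 : 0 ≤ c := by positivity
  have hsδ : 0 ≤ ((s : ℝ) - 1) / δ + 2 := by
    rcases Nat.eq_zero_or_pos s with rfl | hs
    · simp [hδ]
    · have : (1 : ℝ) ≤ s := by exact_mod_cast hs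
      have := div_nonneg (sub_nonneg.2 this) hδpos.le
      linarith
  have hsmall : c * 2 ^ e.primeFactors.card * (((s : ℝ) - 1) / δ + 2) < 1 := by
    set w := 1 - 2 / p₀ ^ ((1 : ℝ) / 2) with hw
    have hsq : 10 ^ 10 ≤ p₀ ^ ((1 : ℝ) / 2) := by
      rw [← Real.sqrt_eq_rpow]
      exact Real.le_sqrt_of_sq_le (by norm_num; linarith)
    have hsq0 : 0 < p₀ ^ ((1 : ℝ) / 2) := by linarith [show (0 : ℝ) < 10 ^ 10 by norm_num]
    have hw1 : w ≤ 1 := by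
      rw [hw]
      have : 0 < 2 / p₀ ^ ((1 : ℝ) / 2) := by positivity
      linarith
    have hw0 : 0 < w := by
      rw [hw, sub_pos, div_lt_one hsq0]
      linarith [show (2 : ℝ) < 10 ^ 10 by norm_num]
    have hw2 : 1 ≤ w ^ (-(1 : ℝ) / 2) := Real.one_le_rpow_of_pos_of_le_one_of_nonpos hw0 hw1
      (by norm_num)
    have hpre : 0 ≤ (Nat.totient e : ℝ) / e * w * (p : ℝ) ^ ((1 : ℝ) / 2) := by positivity
    have h1 := pos_of_mul_pos_right hcrit hpre
    have h2 : c * 2 ^ e.primeFactors.card * (((s : ℝ) - 1) / δ + 2) ≤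
        w ^ (-(1 : ℝ) / 2) * (c * 2 ^ e.primeFactors.card * (((s : ℝ) - 1) / δ + 2)) :=
      le_mul_of_one_le_left (by positivity) hw2
    rw [hc] at h2 ⊢
    linarith
  obtain ⟨B, hB⟩ : ∃ B, B = Nat.sqrt (Nat.sqrt p) := ⟨_, rfl⟩
  obtain ⟨A, hA⟩ : ∃ A, A = B / 2 := ⟨_, rfl⟩
  obtain ⟨M, hM⟩ : ∃ M, M = B ^ 2 / 2 - 3 := ⟨_, rfl⟩
  have hB5 : 10 ^ 5 ≤ B := by
    rw [hB, Nat.le_sqrt, Nat.le_sqrt]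
    exact le_trans (by norm_num) hp20
  have hB2 : B ^ 2 ≤ Nat.sqrt p := hB ▸ Nat.sqrt_le' _
  have hB4 : (B ^ 2) ^ 2 ≤ p := (Nat.pow_le_pow_left hB2 2).trans (Nat.sqrt_le' p)
  have hB10 : 10 ^ 5 * B ≤ B ^ 2 := by
    rw [sq]
    exact Nat.mul_le_mul_right B hB5
  have hB20 : B ^ 2 < (B ^ 2) ^ 2 := lt_self_pow₀ (by omega) (by norm_num)
  have hM0 : 0 < M := by omega
  have hA0 : 0 < A := by omega
  have hMA : M * A < p := by
    have : M * A ≤ B ^ 2 * B := Nat.mul_le_mul (by omega) (by omega)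
    have h : B ^ 2 * B < B ^ 2 * B ^ 2 := Nat.mul_lt_mul_of_pos_left (by omega) (by omega)
    rw [← sq] at h
    omega
  have hAB : 2 * (A * B) ≤ B ^ 2 := by
    rw [← mul_assoc, sq]
    exact Nat.mul_le_mul_right B (by omega)
  set T := (Finset.Icc 1 M ×ˢ Finset.Icc 1 A) ×ˢ Finset.Icc 1 B with hT
  have hTb : ∀ y ∈ T, 0 < y.1.1 + y.1.2 * y.2 ∧ y.1.1 + y.1.2 * y.2 + 3 ≤ B ^ 2 := by
    intro y hy
    simp only [hT, Finset.mem_product, Finset.mem_Icc] at hy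
    have := Nat.mul_le_mul hy.1.2.2 hy.2.2
    omega
  have hTp : ∀ y ∈ T, ((y.1.1 + y.1.2 * y.2 : ℕ) : ZMod p) ≠ 0 := by
    intro y hy h
    rw [ZMod.natCast_eq_zero_iff] at h
    have := hTb y hy
    exact absurd (Nat.le_of_dvd this.1 h) (by omega)
  have hTc : (T.card : ℝ) = M * A * B := by simp [hT]
  have hX : (0 : ℝ) < M * A * B := by
    have : 0 < M * A * B := by positivity
    exact_mod_cast this
  obtain ⟨y, hy, hyS, hyP⟩ := exists_free_of_sieve (T := T)
    (n := fun y => ((y.1.1 + y.1.2 * y.2 : ℕ) : ZMod p)) (E := c * (M * A * B))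
    (S := e.primeFactors) (P := P) (δ := δ)
    (fun χ hχ => by
      refine le_of_pow_le_pow_left₀ (n := 4) (by norm_num) (by positivity) ?_
      rw [hT, Finset.sum_product]
      refine (norm_sum_char_box_pow_four_le (by omega) hχ hMA (by omega) (by omega)).trans ?_
      exact box_bound_le hp20 hB hA hM)
    hTp
    (fun q hq => ⟨Nat.prime_of_mem_primeFactors hq, (Nat.dvd_of_mem_primeFactors hq).trans hed⟩)
    (fun i => ⟨hPprime i, hPdvd i⟩) (fun i h => hPnotdvd i (Nat.dvd_of_mem_primeFactors h))
    hδ hδpos (by positivity)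
    (by
      rw [hTc]
      have := mul_lt_mul_of_pos_right hsmall hX
      linarith)
  obtain ⟨hpos, hle⟩ := hTb y hy
  have hord : orderOf ((y.1.1 + y.1.2 * y.2 : ℕ) : ZMod p) = p - 1 := by
    refine orderOf_eq_of_pow_and_pow_div_prime (by omega)
      (ZMod.pow_card_sub_one_eq_one (hTp y hy)) fun q hq hqp => ?_
    by_cases hqe : q ∣ e
    · exact hyS q (Nat.mem_primeFactors.2 ⟨hq, hqe, he0⟩)
    · obtain ⟨i, rfl⟩ := hPall q hq hqp hqe
      exact hyP i
  have hmin : leastPrimitiveRoot p ≤ y.1.1 + y.1.2 * y.2 := Nat.sInf_le ⟨hpos, hord⟩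
  have h1 : leastPrimitiveRoot p + 3 ≤ Nat.sqrt p := by omega
  have h2 : ((leastPrimitiveRoot p + 3 : ℕ) : ℝ) ≤ √p :=
    (Nat.cast_le.2 h1).trans Real.nat_sqrt_le_real_sqrt
  push_cast at h2
  linarith
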